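/- For every ζ > 0 and positive integers d ≤ k there exist ε₀ = ε₀(ζ,k,d) > 0 and δ₀ = δ₀(ζ,d) > 0 such that the following holds. Let 0 < ε ≤ ε₀ and 0 < δ ≤ δ₀, let μ be an ε-product probability measure on V = V₁×⋯×V_k, and let f : V → ℝ be (d,δ)-global. Then ‖f^{≤d}‖₄⁴ ≤ ζ·‖f‖₂². -/

import Mathlib

open Finset

namespace GLL

variable {k : ℕ} {V : Fin k → Type} [∀ i, Fintype (V i)] [∀ i, DecidableEq (V i)]

/-- Expectation of `f` with respect to the (finitely supported) measure `μ`. -/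
def expect (μ f : (∀ i, V i) → ℝ) : ℝ := ∑ x, μ x * f x

/-- `μ` is a probability measure. -/
def IsProb (μ : (∀ i, V i) → ℝ) : Prop := (∀ x, 0 ≤ μ x) ∧ ∑ x, μ x = 1

/-- The marginal `μ_S` evaluated at (the `S`-coordinates of) `x`. -/
def marg (μ : (∀ i, V i) → ℝ) (S : Finset (Fin k)) (x : ∀ i, V i) : ℝ :=
  ∑ z, if ∀ i ∈ S, z i = x i then μ z else 0

/-- The link (conditional) measure `μ_x` for `x ∈ V_S`, viewed as a measure on
full points agreeing with `x` on `S`. -/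
noncomputable def cond (μ : (∀ i, V i) → ℝ) (S : Finset (Fin k)) (x z : ∀ i, V i) : ℝ :=
  if ∀ i ∈ S, z i = x i then μ z / marg μ S x else 0

/-- The averaging operator `A_S`: `A_S f (x) = E_{y ∼ μ_{x_S}} [f(x_S, y)]`.
Applied to an `S'`-junta `f`, this is also the operator `A_{S',S}`. -/
noncomputable def Aop (μ : (∀ i, V i) → ℝ) (S : Finset (Fin k)) (f : (∀ i, V i) → ℝ)
    (x : ∀ i, V i) : ℝ :=
  ∑ z, cond μ S x z * f z

/-- The Efron–Stein component `f^{=S} = ∑_{T ⊆ S} (-1)^{|S∖T|} A_T f`. -/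
noncomputable def ES (μ : (∀ i, V i) → ℝ) (S : Finset (Fin k)) (f : (∀ i, V i) → ℝ)
    (x : ∀ i, V i) : ℝ :=
  ∑ T ∈ S.powerset, (-1 : ℝ) ^ (S.card - T.card) * Aop μ T f x

/-- The low-degree part `f^{≤ d} = ∑_{|S| ≤ d} f^{=S}`. -/
noncomputable def lowPart (μ : (∀ i, V i) → ℝ) (d : ℕ) (f : (∀ i, V i) → ℝ)
    (x : ∀ i, V i) : ℝ :=
  ∑ S ∈ univ.powerset.filter (fun S : Finset (Fin k) => S.card ≤ d), ES μ S f x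

/-- The Laplacian `L_S[f] = ∑_{T ⊇ S} f^{=T}`. -/
noncomputable def Lap (μ : (∀ i, V i) → ℝ) (S : Finset (Fin k)) (f : (∀ i, V i) → ℝ)
    (x : ∀ i, V i) : ℝ :=
  ∑ T ∈ univ.powerset.filter (fun T : Finset (Fin k) => S ⊆ T), ES μ T f x

/-- The truncated Laplacian `L_S^{≤d}[f] = ∑_{T ⊇ S, |T| ≤ d} f^{=T}`. -/
noncomputable def LapLe (μ : (∀ i, V i) → ℝ) (d : ℕ) (S : Finset (Fin k))
    (f : (∀ i, V i) → ℝ) (x : ∀ i, V i) : ℝ :=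
  ∑ T ∈ univ.powerset.filter (fun T : Finset (Fin k) => S ⊆ T ∧ T.card ≤ d), ES μ T f x

/-- The influence `I_{S,x}[f] = ‖L_S[f](x,·)‖²_{L²(μ_x)}`. -/
noncomputable def Inf (μ : (∀ i, V i) → ℝ) (S : Finset (Fin k)) (f : (∀ i, V i) → ℝ)
    (x : ∀ i, V i) : ℝ :=
  ∑ z, cond μ S x z * (Lap μ S f z) ^ 2

/-- The truncated influence `I^{≤d}_{S,x}[f] = ‖L_S^{≤d}[f](x,·)‖²_{L²(μ_x)}`. -/
noncomputable def InfLe (μ : (∀ i, V i) → ℝ) (d : ℕ) (S : Finset (Fin k))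
    (f : (∀ i, V i) → ℝ) (x : ∀ i, V i) : ℝ :=
  ∑ z, cond μ S x z * (LapLe μ d S f z) ^ 2

/-- `‖f‖₂²` with respect to `μ`. -/
def normSq (μ f : (∀ i, V i) → ℝ) : ℝ := ∑ x, μ x * (f x) ^ 2

/-- `‖f‖₄⁴` with respect to `μ`. -/
def norm4p4 (μ f : (∀ i, V i) → ℝ) : ℝ := ∑ x, μ x * (f x) ^ 4

/-- `‖f‖₂` with respect to `μ`. -/
noncomputable def l2norm (μ f : (∀ i, V i) → ℝ) : ℝ := Real.sqrt (normSq μ f)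

/-- `‖f‖_∞`: the maximum of `|f|` over the support of `μ`. -/
noncomputable def supNorm (μ f : (∀ i, V i) → ℝ) : ℝ :=
  sSup ((fun x => |f x|) '' {x | 0 < μ x})

/-- Inner product `⟨f, g⟩ = E_{x∼μ}[f(x) g(x)]`. -/
def inner' (μ f g : (∀ i, V i) → ℝ) : ℝ := ∑ x, μ x * (f x * g x)

/-- The pair `{i,j}`-skeleton of `μ` is `ε`-pseudorandom. -/
def PairPseudo (μ : (∀ i, V i) → ℝ) (ε : ℝ) (i j : Fin k) : Prop :=
  ∀ (f₁ : V i → ℝ) (f₂ : V j → ℝ),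
    |expect μ (fun x => f₁ (x i) * f₂ (x j)) -
        expect μ (fun x => f₁ (x i)) * expect μ (fun x => f₂ (x j))| ≤
      ε * Real.sqrt
        ((expect μ (fun x => f₁ (x i) ^ 2) - expect μ (fun x => f₁ (x i)) ^ 2) *
          (expect μ (fun x => f₂ (x j) ^ 2) - expect μ (fun x => f₂ (x j)) ^ 2))

/-- `μ` is an `ε`-product measure: every link of every restriction of size `≤ k - 2`
has `ε`-pseudorandom skeletons. -/
def EpsProduct (μ : (∀ i, V i) → ℝ) (ε : ℝ) : Prop :=
  ∀ S : Finset (Fin k), S.card ≤ k - 2 → ∀ x, 0 < marg μ S x →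
    ∀ i j : Fin k, i ∉ S → j ∉ S → i ≠ j → PairPseudo (cond μ S x) ε i j

/-- `‖f(x,·)‖_{L²(μ_x)}` for `x ∈ V_S`. -/
noncomputable def restrictNorm (μ : (∀ i, V i) → ℝ) (S : Finset (Fin k)) (x : ∀ i, V i)
    (f : (∀ i, V i) → ℝ) : ℝ :=
  Real.sqrt (∑ z, cond μ S x z * (f z) ^ 2)

/-- `f` is `(d, δ)`-global: all restrictions of at most `d` coordinates have
`2`-norm at most `δ`. -/
def IsGlobal (μ : (∀ i, V i) → ℝ) (d : ℕ) (δ : ℝ) (f : (∀ i, V i) → ℝ) : Prop :=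
  ∀ S : Finset (Fin k), S.card ≤ d → ∀ x, 0 < marg μ S x → restrictNorm μ S x f ≤ δ

/-- `f` is an `S`-junta: it depends only on the coordinates in `S`. -/
def Junta (S : Finset (Fin k)) (f : (∀ i, V i) → ℝ) : Prop :=
  ∀ x y, (∀ i ∈ S, x i = y i) → f x = f y

/-- The noise operator `T_ρ f = ∑_{S ⊆ [k]} ρ^{|S|} (1-ρ)^{k-|S|} A_S f`. -/
noncomputable def noiseOp (μ : (∀ i, V i) → ℝ) (ρ : ℝ) (f : (∀ i, V i) → ℝ)
    (x : ∀ i, V i) : ℝ :=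
  ∑ S ∈ (univ : Finset (Fin k)).powerset, ρ ^ S.card * (1 - ρ) ^ (k - S.card) * Aop μ S f x

/-- The up-down walk operator `T = (1/k) ∑_{i=1}^k A_{[k]∖{i}}`. -/
noncomputable def upDown (μ : (∀ i, V i) → ℝ) (f : (∀ i, V i) → ℝ) (x : ∀ i, V i) : ℝ :=
  (1 / (k : ℝ)) * ∑ i : Fin k, Aop μ (univ.erase i) f x

/-- The product measure `μ₁ ⊗ ⋯ ⊗ μ_k`. -/
def prodMeasure (μi : ∀ i, V i → ℝ) : (∀ i, V i) → ℝ := fun x => ∏ i, μi i (x i)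

/-- `f` has degree at most `d`: `f^{=S} = 0` whenever `|S| > d`. -/
def DegLe (μ : (∀ i, V i) → ℝ) (d : ℕ) (f : (∀ i, V i) → ℝ) : Prop :=
  ∀ S : Finset (Fin k), d < S.card → ∀ x, ES μ S f x = 0

/-- `{F S}_{S ⊆ [k]}` is an `(α, ε')`-approximate Efron–Stein decomposition of `f`. -/
noncomputable def ApproxES (μ : (∀ i, V i) → ℝ) (α ε' : ℝ) (f : (∀ i, V i) → ℝ)
    (F : Finset (Fin k) → (∀ i, V i) → ℝ) : Prop :=
  l2norm μ f ≤ α ∧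
    l2norm μ (fun x => f x - ∑ S ∈ (univ : Finset (Fin k)).powerset, F S x) ≤ ε' ∧
    ∀ S : Finset (Fin k), ∃ h : (∀ i, V i) → ℝ,
      l2norm μ h ≤ α ∧ l2norm μ (fun x => ES μ S h x - F S x) ≤ ε'

set_option linter.unusedSectionVars false

/-- The averaging operator `A_S` as a linear map. -/
noncomputable def avg (μ : (∀ i, V i) → ℝ) (S : Finset (Fin k)) :
    ((∀ i, V i) → ℝ) →ₗ[ℝ] ((∀ i, V i) → ℝ) where
  toFun := Aop μ S
  map_add' f g := by
    funext x
    simp [Aop, mul_add, Finset.sum_add_distrib]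
  map_smul' c f := by
    funext x
    simp only [Aop, Pi.smul_apply, smul_eq_mul, RingHom.id_apply, Finset.mul_sum]
    exact Finset.sum_congr rfl fun z _ => by ring

theorem avg_apply (μ : (∀ i, V i) → ℝ) (S : Finset (Fin k)) (f : (∀ i, V i) → ℝ)
    (x : ∀ i, V i) : avg μ S f x = ∑ z, cond μ S x z * f z := rfl

theorem marg_nonneg {μ : (∀ i, V i) → ℝ} (hμ : ∀ x, 0 ≤ μ x) (S : Finset (Fin k))
    (x : ∀ i, V i) : 0 ≤ marg μ S x :=
  Finset.sum_nonneg fun z _ => by split_ifs <;> simp [hμ]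

theorem marg_pos {μ : (∀ i, V i) → ℝ} (hμ : ∀ x, 0 ≤ μ x) (S : Finset (Fin k))
    {x : ∀ i, V i} (hx : 0 < μ x) : 0 < marg μ S x := by
  refine Finset.sum_pos' (fun z _ => by split_ifs <;> simp [hμ]) ⟨x, mem_univ _, ?_⟩
  simpa using hx

theorem cond_nonneg {μ : (∀ i, V i) → ℝ} (hμ : ∀ x, 0 ≤ μ x) (S : Finset (Fin k))
    (x z : ∀ i, V i) : 0 ≤ cond μ S x z := by
  unfold cond
  split_ifs
  · exact div_nonneg (hμ z) (marg_nonneg hμ S x)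
  · exact le_rfl

theorem cond_eq_zero {μ : (∀ i, V i) → ℝ} (S : Finset (Fin k)) (x : ∀ i, V i)
    {z : ∀ i, V i} (hz : μ z = 0) : cond μ S x z = 0 := by
  simp [cond, hz]

theorem cond_eq_zero_of_marg {μ : (∀ i, V i) → ℝ} {S : Finset (Fin k)} {x : ∀ i, V i}
    (hx : marg μ S x = 0) (z : ∀ i, V i) : cond μ S x z = 0 := by
  simp [cond, hx]

theorem marg_congr (μ : (∀ i, V i) → ℝ) (S : Finset (Fin k)) : Junta S (marg μ S) := by
  intro x y h
  refine Finset.sum_congr rfl fun z _ => ?_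
  have : (∀ i ∈ S, z i = x i) ↔ ∀ i ∈ S, z i = y i :=
    forall₂_congr fun i hi => by rw [h i hi]
  simp only [this]

theorem sum_cond {μ : (∀ i, V i) → ℝ} {S : Finset (Fin k)} {x : ∀ i, V i}
    (hx : marg μ S x ≠ 0) : ∑ z, cond μ S x z = 1 := by
  have : ∀ z, cond μ S x z = (if ∀ i ∈ S, z i = x i then μ z else 0) / marg μ S x := by
    intro z
    unfold cond
    split_ifs <;> simp
  simp_rw [this, ← Finset.sum_div]
  exact div_self hx

theorem avg_eq_zero_of_marg {μ : (∀ i, V i) → ℝ} {S : Finset (Fin k)} {x : ∀ i, V i}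
    (hx : marg μ S x = 0) (f : (∀ i, V i) → ℝ) : avg μ S f x = 0 := by
  simp [avg_apply, cond_eq_zero_of_marg hx]

theorem avg_mono {μ : (∀ i, V i) → ℝ} (hμ : ∀ x, 0 ≤ μ x) (S : Finset (Fin k))
    {f g : (∀ i, V i) → ℝ} (h : ∀ x, 0 < μ x → f x ≤ g x) (x : ∀ i, V i) :
    avg μ S f x ≤ avg μ S g x := by
  rw [avg_apply, avg_apply]
  refine Finset.sum_le_sum fun z _ => ?_
  rcases (hμ z).eq_or_lt with hz | hz
  · simp [cond_eq_zero S x hz.symm]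
  · exact mul_le_mul_of_nonneg_left (h z hz) (cond_nonneg hμ S x z)

theorem avg_nonneg {μ : (∀ i, V i) → ℝ} (hμ : ∀ x, 0 ≤ μ x) (S : Finset (Fin k))
    {f : (∀ i, V i) → ℝ} (h : ∀ x, 0 < μ x → 0 ≤ f x) (x : ∀ i, V i) :
    0 ≤ avg μ S f x := by
  have := avg_mono hμ S (f := 0) (g := f) h x
  simpa using this

theorem avg_const_le {μ : (∀ i, V i) → ℝ} (S : Finset (Fin k))
    {c : ℝ} (hc : 0 ≤ c) (x : ∀ i, V i) : avg μ S (fun _ => c) x ≤ c := by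
  by_cases hx : marg μ S x = 0
  · rwa [avg_eq_zero_of_marg hx]
  · rw [avg_apply, ← Finset.sum_mul, sum_cond hx, one_mul]

theorem abs_avg_le {μ : (∀ i, V i) → ℝ} (hμ : ∀ x, 0 ≤ μ x) (S : Finset (Fin k))
    (f : (∀ i, V i) → ℝ) (x : ∀ i, V i) : |avg μ S f x| ≤ avg μ S |f| x := by
  rw [abs_le]
  constructor
  · have := avg_mono hμ S (f := -|f|) (g := f) (fun x _ => neg_abs_le (f x)) x
    simpa using this
  · exact avg_mono hμ S (fun x _ => le_abs_self (f x)) x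

theorem avg_junta (μ : (∀ i, V i) → ℝ) (S : Finset (Fin k)) (f : (∀ i, V i) → ℝ) :
    Junta S (avg μ S f) := by
  intro x y h
  rw [avg_apply, avg_apply]
  refine Finset.sum_congr rfl fun z _ => ?_
  have : (∀ i ∈ S, z i = x i) ↔ ∀ i ∈ S, z i = y i :=
    forall₂_congr fun i hi => by rw [h i hi]
  simp only [cond, this, marg_congr μ S x y h]

theorem Junta.mono {S T : Finset (Fin k)} {f : (∀ i, V i) → ℝ} (hf : Junta S f)
    (h : S ⊆ T) : Junta T f := fun x y hxy => hf x y fun i hi => hxy i (h hi)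

theorem Junta.mul {S : Finset (Fin k)} {f g : (∀ i, V i) → ℝ} (hf : Junta S f)
    (hg : Junta S g) : Junta S (f * g) := fun x y h => by
  simp only [Pi.mul_apply, hf x y h, hg x y h]

theorem Junta.pow {S : Finset (Fin k)} {f : (∀ i, V i) → ℝ} (hf : Junta S f) (n : ℕ) :
    Junta S (f ^ n) := fun x y h => by
  simp only [Pi.pow_apply, hf x y h]

theorem Junta.abs {S : Finset (Fin k)} {f : (∀ i, V i) → ℝ} (hf : Junta S f) :
    Junta S |f| := fun x y h => by
  simp only [Pi.abs_apply, hf x y h]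

theorem Junta.smul {S : Finset (Fin k)} {f : (∀ i, V i) → ℝ} (hf : Junta S f) (c : ℝ) :
    Junta S (c • f) := fun x y h => by
  simp only [Pi.smul_apply, hf x y h]

theorem Junta.sum {ι : Type*} {s : Finset ι} {S : Finset (Fin k)} {f : ι → (∀ i, V i) → ℝ}
    (hf : ∀ a ∈ s, Junta S (f a)) : Junta S (∑ a ∈ s, f a) := fun x y h => by
  simp only [Finset.sum_apply]
  exact Finset.sum_congr rfl fun a ha => hf a ha x y h

theorem avg_mul_left (μ : (∀ i, V i) → ℝ) {S : Finset (Fin k)} {f : (∀ i, V i) → ℝ}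
    (hf : Junta S f) (g : (∀ i, V i) → ℝ) : avg μ S (f * g) = f * avg μ S g := by
  funext x
  rw [Pi.mul_apply, avg_apply, avg_apply, Finset.mul_sum]
  refine Finset.sum_congr rfl fun z _ => ?_
  unfold cond
  split_ifs with h
  · rw [Pi.mul_apply, hf z x h]
    ring
  · simp

theorem avg_avg {μ : (∀ i, V i) → ℝ} (hμ : ∀ x, 0 ≤ μ x) {U W : Finset (Fin k)}
    (h : U ⊆ W) (f : (∀ i, V i) → ℝ) : avg μ U (avg μ W f) = avg μ U f := by
  funext x
  rw [avg_apply, avg_apply]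
  simp_rw [avg_apply, Finset.mul_sum]
  rw [Finset.sum_comm]
  refine Finset.sum_congr rfl fun w _ => ?_
  have key : ∀ z, cond μ U x z * (cond μ W z w * f w)
      = (if ∀ i ∈ W, z i = w i then μ z else 0) * (cond μ U x w * f w / marg μ W w) := by
    intro z
    by_cases hz : ∀ i ∈ W, z i = w i
    · have hz' : ∀ i ∈ W, w i = z i := fun i hi => (hz i hi).symm
      have hU : (∀ i ∈ U, z i = x i) ↔ ∀ i ∈ U, w i = x i :=
        forall₂_congr fun i hi => by rw [hz i (h hi)]
      simp only [cond, if_pos hz', if_pos hz, hU, marg_congr μ W z w hz]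
      split_ifs <;> ring
    · have hz' : ¬ ∀ i ∈ W, w i = z i := fun h' => hz fun i hi => (h' i hi).symm
      simp only [cond, if_neg hz', if_neg hz]
      ring
  simp_rw [key]
  rw [← Finset.sum_mul]
  change marg μ W w * _ = _
  rcases (hμ w).eq_or_lt with hw | hw
  · simp [cond_eq_zero U x hw.symm]
  · have := (marg_pos hμ W hw).ne'
    field_simp

theorem avg_avg_mul {μ : (∀ i, V i) → ℝ} (hμ : ∀ x, 0 ≤ μ x) {U W : Finset (Fin k)}
    (h : U ⊆ W) {f : (∀ i, V i) → ℝ} (hf : Junta W f) (g : (∀ i, V i) → ℝ) :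
    avg μ U (f * avg μ W g) = avg μ U (f * g) := by
  rw [← avg_mul_left μ hf, avg_avg hμ h]

theorem avg_mul_sq_le {μ : (∀ i, V i) → ℝ} (hμ : ∀ x, 0 ≤ μ x) (S : Finset (Fin k))
    (f g : (∀ i, V i) → ℝ) (x : ∀ i, V i) :
    (avg μ S (f * g) x) ^ 2 ≤ avg μ S (f ^ 2) x * avg μ S (g ^ 2) x := by
  simp only [avg_apply]
  refine Finset.sum_sq_le_sum_mul_sum_of_sq_le_mul _ (fun z _ => ?_) (fun z _ => ?_)
    (fun z _ => ?_)
  · exact mul_nonneg (cond_nonneg hμ S x z) (by simp [sq_nonneg])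
  · exact mul_nonneg (cond_nonneg hμ S x z) (by simp [sq_nonneg])
  · simp only [Pi.mul_apply, Pi.pow_apply]
    exact le_of_eq (by ring)

theorem avg_sq_nonneg {μ : (∀ i, V i) → ℝ} (hμ : ∀ x, 0 ≤ μ x) (S : Finset (Fin k))
    (f : (∀ i, V i) → ℝ) (x : ∀ i, V i) : 0 ≤ avg μ S (f ^ 2) x :=
  avg_nonneg hμ S (fun z _ => by simp [sq_nonneg]) x

theorem sq_avg_le {μ : (∀ i, V i) → ℝ} (hμ : ∀ x, 0 ≤ μ x) (S : Finset (Fin k))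
    (f : (∀ i, V i) → ℝ) (x : ∀ i, V i) : (avg μ S f x) ^ 2 ≤ avg μ S (f ^ 2) x := by
  have h1 := avg_mul_sq_le hμ S f (fun _ => 1) x
  have h2 : avg μ S ((fun _ => (1 : ℝ)) ^ 2) x ≤ 1 := by
    have : ((fun _ => (1 : ℝ)) ^ 2 : (∀ i, V i) → ℝ) = fun _ => 1 := by
      funext z
      simp
    rw [this]
    exact avg_const_le S zero_le_one x
  have h3 : f * (fun _ => (1 : ℝ)) = f := by
    funext z
    simp
  rw [h3] at h1
  exact h1.trans (mul_le_of_le_one_right (avg_sq_nonneg hμ S f x) h2)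

/-- Conditional contractivity of `A_W` in `L²`. -/
theorem avg_sq_avg_le {μ : (∀ i, V i) → ℝ} (hμ : ∀ x, 0 ≤ μ x) {U W : Finset (Fin k)}
    (h : U ⊆ W) (f : (∀ i, V i) → ℝ) (x : ∀ i, V i) :
    avg μ U (avg μ W f ^ 2) x ≤ avg μ U (f ^ 2) x := by
  rw [← avg_avg hμ h (f ^ 2)]
  exact avg_mono hμ U (fun z _ => sq_avg_le hμ W f z) x

theorem avg_sqrt_mul_le {μ : (∀ i, V i) → ℝ} (hμ : ∀ x, 0 ≤ μ x) (S : Finset (Fin k))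
    {f g : (∀ i, V i) → ℝ} (hf : ∀ x, 0 ≤ f x) (hg : ∀ x, 0 ≤ g x) (x : ∀ i, V i) :
    avg μ S (fun z => √(f z * g z)) x ≤ √(avg μ S f x * avg μ S g x) := by
  refine Real.le_sqrt_of_sq_le ?_
  simp only [avg_apply]
  refine Finset.sum_sq_le_sum_mul_sum_of_sq_le_mul _ (fun z _ => ?_) (fun z _ => ?_)
    (fun z _ => ?_)
  · exact mul_nonneg (cond_nonneg hμ S x z) (hf z)
  · exact mul_nonneg (cond_nonneg hμ S x z) (hg z)
  · rw [mul_pow, Real.sq_sqrt (mul_nonneg (hf z) (hg z))]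
    exact le_of_eq (by ring)

/-- Functions of `R ∪ {i}` and `R ∪ {j}` are nearly independent given the `R`-coordinates. -/
theorem abs_avg_mul_sub_le_of_pair {μ : (∀ i, V i) → ℝ} {ε : ℝ} (hμ : ∀ x, 0 ≤ μ x)
    (hε : 0 ≤ ε) (hP : EpsProduct μ ε) {R : Finset (Fin k)} {i j : Fin k} (hi : i ∉ R)
    (hj : j ∉ R) (hij : i ≠ j) {g h : (∀ i, V i) → ℝ} (hg : Junta (insert i R) g)
    (hh : Junta (insert j R) h) (x : ∀ i, V i) :
    |avg μ R (g * h) x - avg μ R g x * avg μ R h x|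
      ≤ ε * √(avg μ R (g ^ 2) x * avg μ R (h ^ 2) x) := by
  rcases (marg_nonneg hμ R x).eq_or_lt with hx | hx
  · simp [avg_eq_zero_of_marg hx.symm]
  have hcard : R.card ≤ k - 2 := by
    have h1 : (insert i (insert j R)).card = R.card + 2 := by
      rw [card_insert_of_notMem (by simp [hij, hi]), card_insert_of_notMem hj]
    have h2 := card_le_univ (insert i (insert j R))
    rw [Fintype.card_fin] at h2
    omega
  have key := hP R hcard x hx i j hi hj hij (fun a => g (Function.update x i a))
    (fun a => h (Function.update x j a))
  have conv : ∀ (l : Fin k) (u : (∀ i, V i) → ℝ), Junta (insert l R) u → ∀ z,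
      (∀ m ∈ R, z m = x m) → u (Function.update x l (z l)) = u z := by
    intro l u hu z hz
    refine hu _ _ fun m hm => ?_
    by_cases hml : m = l
    · subst hml
      simp
    · rw [Function.update_of_ne hml, hz m ((mem_insert.1 hm).resolve_left hml)]
  have e : ∀ u v : (∀ i, V i) → ℝ, (∀ z, (∀ m ∈ R, z m = x m) → u z = v z) →
      expect (cond μ R x) u = avg μ R v x := by
    intro u v huv
    rw [avg_apply]
    refine Finset.sum_congr rfl fun z _ => ?_
    by_cases hz : ∀ m ∈ R, z m = x m
    · rw [huv z hz]
    · simp [cond, if_neg hz]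
  rw [e _ (g * h) fun z hz => by simp only [Pi.mul_apply, conv i g hg z hz, conv j h hh z hz],
    e _ g fun z hz => conv i g hg z hz, e _ h fun z hz => conv j h hh z hz,
    e _ (g ^ 2) fun z hz => by simp only [Pi.pow_apply, conv i g hg z hz],
    e _ (h ^ 2) fun z hz => by simp only [Pi.pow_apply, conv j h hh z hz]] at key
  refine key.trans (mul_le_mul_of_nonneg_left (Real.sqrt_le_sqrt ?_) hε)
  refine mul_le_mul (by nlinarith [sq_nonneg (avg μ R g x)])
    (by nlinarith [sq_nonneg (avg μ R h x)]) ?_ (avg_sq_nonneg hμ R g x)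
  linarith [sq_avg_le hμ R h x]

/-- Functions of `S` and of `T` are nearly independent given the coordinates in `S ∩ T`,
where `|S ∖ T| = s` and `|T ∖ S| = t`. -/
def CondIndep (μ : (∀ i, V i) → ℝ) (ε : ℝ) (s t : ℕ) : Prop :=
  ∀ (U S T : Finset (Fin k)) (g h : (∀ i, V i) → ℝ), U ⊆ S ∩ T → (S \ T).card = s →
    (T \ S).card = t → Junta S g → Junta T h → ∀ x,
      |avg μ U (g * h) x - avg μ U (avg μ (S ∩ T) g * avg μ (S ∩ T) h) x|
        ≤ ε * (s * t) * √(avg μ U (g ^ 2) x * avg μ U (h ^ 2) x)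

theorem CondIndep.symm {μ : (∀ i, V i) → ℝ} {ε : ℝ} {s t : ℕ} (H : CondIndep μ ε s t) :
    CondIndep μ ε t s := by
  intro U S T g h hU hs ht hg hh x
  have := H U T S h g (by rwa [inter_comm]) ht hs hh hg x
  rw [inter_comm T S, mul_comm h g, mul_comm (avg μ (S ∩ T) h), mul_comm (s : ℝ),
    mul_comm (avg μ U (h ^ 2) x)] at this
  exact this

theorem condIndep_one_one {μ : (∀ i, V i) → ℝ} {ε : ℝ} (hμ : ∀ x, 0 ≤ μ x)
    (hε : 0 ≤ ε) (hP : EpsProduct μ ε) : CondIndep μ ε 1 1 := by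
  intro U S T g h hU hs ht hg hh x
  obtain ⟨i, hi⟩ := card_eq_one.1 hs
  obtain ⟨j, hj⟩ := card_eq_one.1 ht
  have hi' : i ∈ S ∧ i ∉ T := by rw [← mem_sdiff, hi]; simp
  have hj' : j ∈ T ∧ j ∉ S := by rw [← mem_sdiff, hj]; simp
  have hS : S = insert i (S ∩ T) := by
    rw [insert_eq, ← hi, sdiff_union_inter]
  have hT : T = insert j (S ∩ T) := by
    rw [insert_eq, ← hj, inter_comm, sdiff_union_inter]
  set R := S ∩ T with hR
  have hij : i ≠ j := fun e => hi'.2 (e ▸ hj'.1)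
  have hiR : i ∉ R := by simp [hR, hi'.2]
  have hjR : j ∉ R := by simp [hR, hj'.2]
  rw [hS] at hg
  rw [hT] at hh
  rw [← avg_avg hμ hU (g * h), ← Pi.sub_apply, ← map_sub]
  refine (abs_avg_le hμ U _ x).trans ?_
  have h1 : avg μ U |avg μ R (g * h) - avg μ R g * avg μ R h| x
      ≤ avg μ U (ε • fun z => √(avg μ R (g ^ 2) z * avg μ R (h ^ 2) z)) x :=
    avg_mono hμ U (fun z _ => abs_avg_mul_sub_le_of_pair hμ hε hP hiR hjR hij hg hh z) x
  refine h1.trans ?_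
  rw [map_smul, Pi.smul_apply, smul_eq_mul]
  have h2 := avg_sqrt_mul_le hμ U (avg_sq_nonneg hμ R g) (avg_sq_nonneg hμ R h) x
  rw [avg_avg hμ hU, avg_avg hμ hU] at h2
  simpa using mul_le_mul_of_nonneg_left h2 hε

theorem CondIndep.of_one {μ : (∀ i, V i) → ℝ} {ε : ℝ} (hμ : ∀ x, 0 ≤ μ x) (hε : 0 ≤ ε)
    {t : ℕ} (H : CondIndep μ ε 1 t) (s : ℕ) : CondIndep μ ε s t := by
  induction s with
  | zero =>
    intro U S T g h hU hs ht hg hh x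
    have hST : S ⊆ T := by rwa [card_eq_zero, sdiff_eq_empty_iff_subset] at hs
    have hI : S ∩ T = S := inter_eq_left.2 hST
    rw [hI] at hU ⊢
    have h1 : avg μ S g = g * avg μ S 1 := by rw [← avg_mul_left μ hg, mul_one]
    have h2 : avg μ S 1 * avg μ S h = avg μ S h := by
      rw [mul_comm, ← avg_mul_left μ (avg_junta μ S h), mul_one, avg_avg hμ subset_rfl]
    rw [h1, mul_assoc, h2, avg_avg_mul hμ hU hg]
    simp
  | succ s ih =>
    intro U S T g h hU hs ht hg hh x
    obtain ⟨i, hi⟩ : (S \ T).Nonempty := by rw [← card_pos]; omega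
    obtain ⟨hiS, hiT⟩ := mem_sdiff.1 hi
    have hM : S ∩ insert i T = insert i (S ∩ T) := by
      rw [inter_insert_of_mem hiS]
    set M := insert i (S ∩ T) with hMdef
    have hUM : U ⊆ M := hU.trans (subset_insert _ _)
    have hMT : M ∩ T = S ∩ T := by
      rw [hMdef, insert_inter_of_notMem hiT, inter_assoc, inter_self]
    have c1 : (S \ insert i T).card = s := by
      have : S \ insert i T = (S \ T).erase i := by
        ext a
        simp only [mem_sdiff, mem_insert, mem_erase]
        tauto
      rw [this, card_erase_of_mem hi, hs]
      rfl
    have c2 : (insert i T \ S).card = t := by rw [insert_sdiff_of_mem _ hiS, ht]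
    have c3 : (M \ T).card = 1 := by
      have : M \ T = {i} := by
        ext a
        simp only [hMdef, mem_sdiff, mem_insert, mem_inter, mem_singleton]
        constructor
        · tauto
        · rintro rfl
          exact ⟨Or.inl rfl, hiT⟩
      rw [this, card_singleton]
    have c4 : (T \ M).card = t := by
      have : T \ M = T \ S := by
        ext a
        simp only [hMdef, mem_sdiff, mem_insert, mem_inter]
        constructor
        · tauto
        · rintro ⟨h1, h2⟩
          exact ⟨h1, fun h3 => h3.elim (fun h4 => hiT (h4 ▸ h1)) fun h4 => h2 h4.1⟩
      rw [this, ht]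
    have b1 := ih U S (insert i T) g h (by rwa [hM]) c1 c2 hg (hh.mono (subset_insert _ _)) x
    rw [hM, avg_avg_mul hμ hUM (avg_junta μ M g)] at b1
    have b2 := H U M T (avg μ M g) h (by rwa [hMT]) c3 c4 (avg_junta μ M g) hh x
    rw [hMT, avg_avg hμ (subset_insert _ _)] at b2
    have b3 : √(avg μ U (avg μ M g ^ 2) x * avg μ U (h ^ 2) x)
        ≤ √(avg μ U (g ^ 2) x * avg μ U (h ^ 2) x) :=
      Real.sqrt_le_sqrt (mul_le_mul_of_nonneg_right (avg_sq_avg_le hμ hUM g x)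
        (avg_sq_nonneg hμ U h x))
    have b4 : ε * ((1 : ℕ) * t) * √(avg μ U (avg μ M g ^ 2) x * avg μ U (h ^ 2) x)
        ≤ ε * ((1 : ℕ) * t) * √(avg μ U (g ^ 2) x * avg μ U (h ^ 2) x) :=
      mul_le_mul_of_nonneg_left b3 (by positivity)
    have b5 := abs_sub_le (avg μ U (g * h) x) (avg μ U (avg μ M g * h) x)
      (avg μ U (avg μ (S ∩ T) g * avg μ (S ∩ T) h) x)
    push_cast at b4 b2 ⊢
    linarith

theorem abs_avg_mul_sub_le {μ : (∀ i, V i) → ℝ} {ε : ℝ} (hμ : ∀ x, 0 ≤ μ x) (hε : 0 ≤ ε)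
    (hP : EpsProduct μ ε) {U S T : Finset (Fin k)} {g h : (∀ i, V i) → ℝ} (hU : U ⊆ S ∩ T)
    (hg : Junta S g) (hh : Junta T h) (x : ∀ i, V i) :
    |avg μ U (g * h) x - avg μ U (avg μ (S ∩ T) g * avg μ (S ∩ T) h) x|
      ≤ ε * k ^ 2 * √(avg μ U (g ^ 2) x * avg μ U (h ^ 2) x) := by
  have H1 : CondIndep μ ε 1 (T \ S).card :=
    ((condIndep_one_one hμ hε hP).of_one hμ hε (T \ S).card).symm
  have H2 := H1.of_one hμ hε (S \ T).card U S T g h hU rfl rfl hg hh x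
  refine H2.trans (mul_le_mul_of_nonneg_right (mul_le_mul_of_nonneg_left ?_ hε)
    (Real.sqrt_nonneg _))
  have c : ∀ A : Finset (Fin k), (A.card : ℝ) ≤ k := fun A => by
    have := card_le_univ A
    rw [Fintype.card_fin] at this
    exact_mod_cast this
  rw [sq]
  exact mul_le_mul (c _) (c _) (by positivity) (by positivity)

/-- The Efron–Stein component on the coordinates `P` of the link over the coordinates `U`. -/
noncomputable def linkES (μ : (∀ i, V i) → ℝ) (U P : Finset (Fin k)) (f : (∀ i, V i) → ℝ) :
    (∀ i, V i) → ℝ :=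
  ∑ T ∈ P.powerset, (-1 : ℝ) ^ (P.card - T.card) • avg μ (U ∪ T) f

theorem linkES_junta (μ : (∀ i, V i) → ℝ) (U P : Finset (Fin k)) (f : (∀ i, V i) → ℝ) :
    Junta (U ∪ P) (linkES μ U P f) :=
  Junta.sum fun T hT => ((avg_junta μ (U ∪ T) f).mono
    (union_subset_union_right (mem_powerset.1 hT))).smul _

theorem ES_eq_linkES (μ : (∀ i, V i) → ℝ) (S : Finset (Fin k)) (f : (∀ i, V i) → ℝ) :
    ES μ S f = linkES μ ∅ S f := by
  funext x
  simp only [ES, linkES, Finset.sum_apply, Pi.smul_apply, smul_eq_mul, empty_union]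
  rfl

/-- A component of the link is nearly orthogonal to functions that do not see all of its
coordinates. -/
theorem abs_avg_mul_linkES_le {μ : (∀ i, V i) → ℝ} {ε : ℝ} (hμ : ∀ x, 0 ≤ μ x) (hε : 0 ≤ ε)
    (hP : EpsProduct μ ε) {U W P : Finset (Fin k)} {h : (∀ i, V i) → ℝ}
    (f : (∀ i, V i) → ℝ) (hU : U ⊆ W) (hh : Junta W h) (hPW : ¬ P ⊆ W) (x : ∀ i, V i) :
    |avg μ U (h * linkES μ U P f) x|
      ≤ ε * (2 ^ k * k ^ 2) * √(avg μ U (h ^ 2) x * avg μ U (f ^ 2) x) := by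
  obtain ⟨i, hiP, hiW⟩ := not_subset.1 hPW
  obtain ⟨Q, hiQ, rfl⟩ : ∃ Q, i ∉ Q ∧ insert i Q = P :=
    ⟨P.erase i, notMem_erase i P, insert_erase hiP⟩
  set N := √(avg μ U (h ^ 2) x * avg μ U (f ^ 2) x) with hN
  have hQ : Q.card + 1 ≤ k := by
    have := card_le_univ (insert i Q)
    rwa [Fintype.card_fin, card_insert_of_notMem hiQ] at this
  have approx : ∀ T : Finset (Fin k),
      |avg μ U (h * avg μ (U ∪ T) f) x
        - avg μ U (avg μ (W ∩ (U ∪ T)) h * avg μ (W ∩ (U ∪ T)) f) x| ≤ ε * k ^ 2 * N := by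
    intro T
    have hsub : U ⊆ W ∩ (U ∪ T) := subset_inter hU subset_union_left
    have h1 := abs_avg_mul_sub_le hμ hε hP hsub hh (avg_junta μ (U ∪ T) f) x
    rw [avg_avg hμ inter_subset_right] at h1
    refine h1.trans (mul_le_mul_of_nonneg_left (Real.sqrt_le_sqrt ?_) (by positivity))
    exact mul_le_mul_of_nonneg_left (avg_sq_avg_le hμ subset_union_left f x)
      (avg_sq_nonneg hμ U h x)
  have hsplit : linkES μ U (insert i Q) f = ∑ T ∈ Q.powerset, (-1 : ℝ) ^ (Q.card - T.card) •
      (avg μ (U ∪ insert i T) f - avg μ (U ∪ T) f) := by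
    rw [linkES, Finset.sum_powerset_insert hiQ, ← Finset.sum_add_distrib]
    refine Finset.sum_congr rfl fun T hT => ?_
    have hTQ := mem_powerset.1 hT
    have hc := card_le_card hTQ
    rw [card_insert_of_notMem hiQ, card_insert_of_notMem (fun h' => hiQ (hTQ h')),
      Nat.add_sub_add_right, Nat.succ_sub hc, pow_succ]
    simp only [smul_sub, mul_neg, mul_one, neg_smul]
    abel
  rw [hsplit, Finset.mul_sum, map_sum, Finset.sum_apply]
  have hterm : ∀ T ∈ Q.powerset, |avg μ U (h * ((-1 : ℝ) ^ (Q.card - T.card) •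
      (avg μ (U ∪ insert i T) f - avg μ (U ∪ T) f))) x| ≤ 2 * (ε * k ^ 2 * N) := by
    intro T _
    have hI : W ∩ (U ∪ insert i T) = W ∩ (U ∪ T) := by
      rw [union_insert, inter_insert_of_notMem hiW]
    have h1 := approx (insert i T)
    rw [hI] at h1
    have h2 := approx T
    rw [mul_smul_comm, map_smul, Pi.smul_apply, smul_eq_mul, abs_mul, abs_pow, abs_neg,
      abs_one, one_pow, one_mul, mul_sub, map_sub, Pi.sub_apply]
    rw [abs_le] at h1 h2 ⊢
    constructor <;> linarith [h1.1, h1.2, h2.1, h2.2]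
  refine (Finset.abs_sum_le_sum_abs _ _).trans ((Finset.sum_le_sum hterm).trans ?_)
  rw [Finset.sum_const, card_powerset, nsmul_eq_mul]
  have h2k : (2 : ℝ) ^ Q.card * 2 ≤ 2 ^ k := by
    rw [← pow_succ]
    exact pow_le_pow_right₀ one_le_two hQ
  have h0 : 0 ≤ ε * k ^ 2 * N := by positivity
  push_cast
  nlinarith [mul_le_mul_of_nonneg_right h2k h0]

theorem abs_linkES_le {μ : (∀ i, V i) → ℝ} {U P : Finset (Fin k)} {f : (∀ i, V i) → ℝ}
    {δ : ℝ} {x : ∀ i, V i} (h : ∀ T ⊆ P, |avg μ (U ∪ T) f x| ≤ δ) :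
    |linkES μ U P f x| ≤ 2 ^ P.card * δ := by
  rw [linkES, Finset.sum_apply]
  refine (Finset.abs_sum_le_sum_abs _ _).trans ?_
  have : ∀ T ∈ P.powerset, |((-1 : ℝ) ^ (P.card - T.card) • avg μ (U ∪ T) f) x| ≤ δ := by
    intro T hT
    rw [Pi.smul_apply, smul_eq_mul, abs_mul, abs_pow, abs_neg, abs_one, one_pow, one_mul]
    exact h T (mem_powerset.1 hT)
  refine (Finset.sum_le_sum this).trans ?_
  rw [Finset.sum_const, card_powerset, nsmul_eq_mul]
  push_cast
  rfl

theorem sum_sq_le_card_mul {ι : Type*} (s : Finset ι) (a : ι → ((∀ i, V i) → ℝ))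
    (x : ∀ i, V i) : ((∑ i ∈ s, a i) ^ 2) x ≤ (s.card • ∑ i ∈ s, a i ^ 2) x := by
  simp only [Pi.pow_apply, Finset.sum_apply, Pi.smul_apply, nsmul_eq_mul]
  exact sq_sum_le_card_mul_sum_sq

theorem avg_linkES_sq_le {μ : (∀ i, V i) → ℝ} (hμ : ∀ x, 0 ≤ μ x) {U' U : Finset (Fin k)}
    (hU : U' ⊆ U) (P : Finset (Fin k)) (f : (∀ i, V i) → ℝ) (x : ∀ i, V i) :
    avg μ U' (linkES μ U P f ^ 2) x ≤ (2 ^ P.card) ^ 2 * avg μ U' (f ^ 2) x := by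
  have h1 := avg_mono hμ U' (fun z _ => sum_sq_le_card_mul P.powerset
    (fun T => (-1 : ℝ) ^ (P.card - T.card) • avg μ (U ∪ T) f) z) x
  change avg μ U' (linkES μ U P f ^ 2) x ≤ _ at h1
  refine h1.trans ?_
  rw [map_nsmul, map_sum, Pi.smul_apply, Finset.sum_apply, nsmul_eq_mul, card_powerset, sq,
    mul_assoc]
  push_cast
  refine mul_le_mul_of_nonneg_left ?_ (by positivity)
  have : ∀ T ∈ P.powerset, avg μ U' (((-1 : ℝ) ^ (P.card - T.card) • avg μ (U ∪ T) f) ^ 2) x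
      ≤ avg μ U' (f ^ 2) x := by
    intro T _
    rw [smul_pow, ← pow_mul, mul_comm _ 2, pow_mul, neg_one_sq, one_pow, one_smul]
    exact avg_sq_avg_le hμ (hU.trans subset_union_left) f x
  refine (Finset.sum_le_sum this).trans ?_
  rw [Finset.sum_const, card_powerset, nsmul_eq_mul]
  push_cast
  rfl

/-- Approximate Bessel inequality in the link over `U`. -/
theorem sum_avg_linkES_sq_le {μ : (∀ i, V i) → ℝ} {ε : ℝ} (hμ : ∀ x, 0 ≤ μ x) (hε : 0 ≤ ε)
    (hP : EpsProduct μ ε) (hsmall : ε * (3 * (2 ^ k) ^ 4 * k ^ 2) ≤ 1) (U : Finset (Fin k))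
    (Ps : Finset (Finset (Fin k))) (hdisj : ∀ P ∈ Ps, Disjoint U P) (f : (∀ i, V i) → ℝ)
    (x : ∀ i, V i) :
    ∑ P ∈ Ps, avg μ U (linkES μ U P f ^ 2) x ≤ 2 * avg μ U (f ^ 2) x := by
  set N : ℝ := 2 ^ k with hN
  have hN1 : 1 ≤ N := one_le_pow₀ one_le_two
  set n := avg μ U (f ^ 2) x with hn
  have hn0 : 0 ≤ n := avg_sq_nonneg hμ U f x
  have hpow : ∀ P : Finset (Fin k), (2 : ℝ) ^ P.card ≤ N := fun P => by
    have := card_le_univ P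
    rw [Fintype.card_fin] at this
    exact pow_le_pow_right₀ one_le_two this
  have hcard : (Ps.card : ℝ) ≤ N := by
    have := card_le_univ Ps
    rw [Fintype.card_finset, Fintype.card_fin] at this
    rw [hN]
    exact_mod_cast this
  have hnot : ∀ P ∈ Ps, ∀ Q, ¬ P ⊆ Q → ¬ P ⊆ U ∪ Q := fun P hPs Q h h' =>
    h ((hdisj P hPs).symm.left_le_of_le_sup_left h')
  have horth : ∀ P ∈ Ps, ∀ Q, ¬ P ⊆ Q →
      |avg μ U (linkES μ U Q f * linkES μ U P f) x| ≤ ε * (N * k ^ 2) * (N * n) := by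
    intro P hPs Q h
    refine (abs_avg_mul_linkES_le hμ hε hP f subset_union_left (linkES_junta μ U Q f)
      (hnot P hPs Q h) x).trans (mul_le_mul_of_nonneg_left ?_ (by positivity))
    rw [Real.sqrt_le_left (by positivity)]
    have h1 := avg_linkES_sq_le hμ (subset_refl U) Q f x
    have h2 : ((2 : ℝ) ^ Q.card) ^ 2 ≤ N ^ 2 := pow_le_pow_left₀ (by positivity) (hpow Q) 2
    calc _ ≤ (N ^ 2 * n) * n := mul_le_mul_of_nonneg_right
            (h1.trans (mul_le_mul_of_nonneg_right h2 hn0)) hn0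
      _ = _ := by ring
  have hoff : ∀ P ∈ Ps, ∀ Q ∈ Ps, P ≠ Q →
      avg μ U (linkES μ U P f * linkES μ U Q f) x ≤ ε * (N * k ^ 2) * (N * n) := by
    intro P hPs Q hQs hne
    by_cases h : P ⊆ Q
    · exact (le_abs_self _).trans (horth Q hQs P fun h' => hne (h.antisymm h'))
    · rw [mul_comm]
      exact (le_abs_self _).trans (horth P hPs Q h)
  have hdiag : ∀ P ∈ Ps, avg μ U (linkES μ U P f ^ 2) x - avg μ U (f * linkES μ U P f) x
      ≤ N * (ε * (N * k ^ 2) * n) := by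
    intro P hPs
    have hsplit : linkES μ U P f = avg μ (U ∪ P) f + ∑ T ∈ P.powerset.erase P,
        (-1 : ℝ) ^ (P.card - T.card) • avg μ (U ∪ T) f := by
      rw [linkES, ← Finset.add_sum_erase _ _ (mem_powerset_self P)]
      simp
    have h1 : avg μ U (f * linkES μ U P f) x
        = avg μ U (linkES μ U P f * avg μ (U ∪ P) f) x := by
      rw [avg_avg_mul hμ subset_union_left (linkES_junta μ U P f), mul_comm]
    have h2 : avg μ U (linkES μ U P f ^ 2) x - avg μ U (f * linkES μ U P f) x
        = ∑ T ∈ P.powerset.erase P,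
          (-1 : ℝ) ^ (P.card - T.card) * avg μ U (avg μ (U ∪ T) f * linkES μ U P f) x := by
      rw [h1, ← Pi.sub_apply, ← map_sub, sq, ← mul_sub]
      conv_lhs => rw [show linkES μ U P f - avg μ (U ∪ P) f = ∑ T ∈ P.powerset.erase P,
        (-1 : ℝ) ^ (P.card - T.card) • avg μ (U ∪ T) f from sub_eq_of_eq_add' hsplit]
      rw [Finset.mul_sum, map_sum, Finset.sum_apply]
      refine Finset.sum_congr rfl fun T _ => ?_
      rw [mul_smul_comm, map_smul, Pi.smul_apply, smul_eq_mul, mul_comm (linkES μ U P f)]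
    rw [h2]
    have h3 : ∀ T ∈ P.powerset.erase P,
        (-1 : ℝ) ^ (P.card - T.card) * avg μ U (avg μ (U ∪ T) f * linkES μ U P f) x
          ≤ ε * (N * k ^ 2) * n := by
      intro T hT
      obtain ⟨hne, hTP⟩ := mem_erase.1 hT
      have hnPT : ¬ P ⊆ T := fun h => hne ((mem_powerset.1 hTP).antisymm h)
      refine (le_abs_self _).trans ?_
      rw [abs_mul, abs_pow, abs_neg, abs_one, one_pow, one_mul]
      refine (abs_avg_mul_linkES_le hμ hε hP f subset_union_left (avg_junta μ (U ∪ T) f)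
        (hnot P hPs T hnPT) x).trans (mul_le_mul_of_nonneg_left ?_ (by positivity))
      rw [Real.sqrt_le_left hn0, sq n]
      exact mul_le_mul_of_nonneg_right (avg_sq_avg_le hμ subset_union_left f x) hn0
    refine (Finset.sum_le_sum h3).trans ?_
    rw [Finset.sum_const, nsmul_eq_mul]
    refine mul_le_mul_of_nonneg_right ?_ (by positivity)
    have : ((P.powerset.erase P).card : ℝ) ≤ 2 ^ P.card := by
      have := card_erase_le (s := P.powerset) (a := P)
      rw [card_powerset] at this
      exact_mod_cast this
    exact this.trans (hpow P)
  set B := ∑ P ∈ Ps, avg μ U (linkES μ U P f ^ 2) x with hB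
  have hsum1 : B - ∑ P ∈ Ps, avg μ U (f * linkES μ U P f) x
      ≤ N * (N * (ε * (N * k ^ 2) * n)) := by
    rw [hB, ← Finset.sum_sub_distrib]
    refine (Finset.sum_le_sum hdiag).trans ?_
    rw [Finset.sum_const, nsmul_eq_mul]
    exact mul_le_mul_of_nonneg_right hcard (by positivity)
  have hsum2 : ∑ P ∈ Ps, ∑ Q ∈ Ps, avg μ U (linkES μ U P f * linkES μ U Q f) x
      ≤ B + N * (N * (ε * (N * k ^ 2) * (N * n))) := by
    have h1 : ∀ P ∈ Ps, ∑ Q ∈ Ps, avg μ U (linkES μ U P f * linkES μ U Q f) x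
        ≤ avg μ U (linkES μ U P f ^ 2) x + N * (ε * (N * k ^ 2) * (N * n)) := by
      intro P hPs
      rw [← Finset.add_sum_erase _ _ hPs, sq]
      refine add_le_add_right ((Finset.sum_le_sum fun Q hQ =>
        hoff P hPs Q (mem_of_mem_erase hQ) (ne_of_mem_erase hQ).symm).trans ?_) _
      rw [Finset.sum_const, nsmul_eq_mul]
      refine mul_le_mul_of_nonneg_right (le_trans ?_ hcard) (by positivity)
      exact_mod_cast card_erase_le
    refine (Finset.sum_le_sum h1).trans ?_
    rw [Finset.sum_add_distrib, Finset.sum_const, nsmul_eq_mul]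
    exact add_le_add_right (mul_le_mul_of_nonneg_right hcard (by positivity)) _
  have hexp : avg μ U ((f - ∑ P ∈ Ps, linkES μ U P f) ^ 2) x
      = n - 2 * ∑ P ∈ Ps, avg μ U (f * linkES μ U P f) x
        + ∑ P ∈ Ps, ∑ Q ∈ Ps, avg μ U (linkES μ U P f * linkES μ U Q f) x := by
    have : (f - ∑ P ∈ Ps, linkES μ U P f) ^ 2 = f ^ 2 - (2 : ℝ) • ∑ P ∈ Ps, f * linkES μ U P f
        + ∑ P ∈ Ps, ∑ Q ∈ Ps, linkES μ U P f * linkES μ U Q f := by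
      rw [← Finset.mul_sum, ← Finset.sum_mul_sum, ofNat_smul_eq_nsmul ℝ]
      ring
    rw [this]
    simp only [map_add, map_sub, map_smul, map_sum, Pi.add_apply, Pi.sub_apply, Pi.smul_apply,
      Finset.sum_apply, smul_eq_mul, hn]
  have h0 := avg_sq_nonneg hμ U (f - ∑ P ∈ Ps, linkES μ U P f) x
  rw [hexp] at h0
  have hX : 0 ≤ ε * k ^ 2 * n := by positivity
  have hN34 : N ^ 3 ≤ N ^ 4 := pow_le_pow_right₀ hN1 (by norm_num)
  have e1 := mul_le_mul_of_nonneg_right hN34 hX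
  have e2 := mul_le_mul_of_nonneg_right hsmall hn0
  nlinarith
/-- Expansion of a global component through the components of the links over `T ⊆ R`. -/
theorem linkES_union (μ : (∀ i, V i) → ℝ) {R P : Finset (Fin k)} (hRP : Disjoint R P)
    (f : (∀ i, V i) → ℝ) : linkES μ ∅ (R ∪ P) f
      = ∑ T ∈ R.powerset, (-1 : ℝ) ^ (R.card - T.card) • linkES μ T P f := by
  simp only [linkES, Finset.smul_sum, smul_smul, empty_union]
  rw [← Finset.sum_product']
  refine Finset.sum_nbij' (fun T => (T ∩ R, T ∩ P)) (fun p => p.1 ∪ p.2) ?_ ?_ ?_ ?_ ?_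
  · intro T _
    simp [inter_subset_right]
  · rintro ⟨A, B⟩ h
    simp only [mem_product, mem_powerset] at h ⊢
    exact union_subset_union h.1 h.2
  · intro T hT
    rw [← inter_union_distrib_left]
    exact inter_eq_left.2 (mem_powerset.1 hT)
  · rintro ⟨A, B⟩ h
    simp only [mem_product, mem_powerset] at h
    have h1 : B ∩ R = ∅ := disjoint_iff_inter_eq_empty.1 (hRP.symm.mono_left h.2)
    have h2 : A ∩ P = ∅ := disjoint_iff_inter_eq_empty.1 (hRP.mono_left h.1)
    simp only [union_inter_distrib_right, h1, h2, inter_eq_left.2 h.1, inter_eq_left.2 h.2,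
      union_empty, empty_union]
  · intro T hT
    have hT' : T ∩ R ∪ T ∩ P = T := by
      rw [← inter_union_distrib_left]
      exact inter_eq_left.2 (mem_powerset.1 hT)
    have hc : T.card = (T ∩ R).card + (T ∩ P).card := by
      rw [← card_union_of_disjoint (hRP.mono inter_subset_right inter_subset_right), hT']
    have h1 := card_le_card (inter_subset_right : T ∩ R ⊆ R)
    have h2 := card_le_card (inter_subset_right : T ∩ P ⊆ P)
    rw [hT', ← pow_add, card_union_of_disjoint hRP, hc]
    congr 2
    dsimp only
    omega

theorem avg_mul_le_of_le {μ : (∀ i, V i) → ℝ} (hμ : ∀ x, 0 ≤ μ x) (S : Finset (Fin k))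
    {g h : (∀ i, V i) → ℝ} {c : ℝ} (hg : ∀ z, g z ≤ c) (hh : ∀ z, 0 ≤ h z) (x : ∀ i, V i) :
    avg μ S (g * h) x ≤ c * avg μ S h x := by
  rw [← smul_eq_mul c, ← Pi.smul_apply, ← map_smul]
  exact avg_mono hμ S (fun z _ => mul_le_mul_of_nonneg_right (hg z) (hh z)) x

/-- All restrictions of at most `d` coordinates have squared `2`-norm at most `δ²`. -/
def SqGlobal (μ : (∀ i, V i) → ℝ) (d : ℕ) (δ : ℝ) (f : (∀ i, V i) → ℝ) : Prop :=
  ∀ S : Finset (Fin k), S.card ≤ d → ∀ z, avg μ S (f ^ 2) z ≤ δ ^ 2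

theorem IsGlobal.sqGlobal {μ : (∀ i, V i) → ℝ} (hμ : ∀ x, 0 ≤ μ x) {d : ℕ} {δ : ℝ}
    (hδ : 0 ≤ δ) {f : (∀ i, V i) → ℝ} (h : IsGlobal μ d δ f) : SqGlobal μ d δ f := by
  intro S hS z
  rcases (marg_nonneg hμ S z).eq_or_lt with hz | hz
  · rw [avg_eq_zero_of_marg hz.symm]
    positivity
  · exact (Real.sqrt_le_left hδ).1 (h S hS z hz)

theorem two_pow_card_le (P : Finset (Fin k)) : (2 : ℝ) ^ P.card ≤ 2 ^ k := by
  have := card_le_univ P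
  rw [Fintype.card_fin] at this
  exact pow_le_pow_right₀ one_le_two this

theorem card_family_le (Ps : Finset (Finset (Fin k))) : (Ps.card : ℝ) ≤ 2 ^ k := by
  have := card_le_univ Ps
  rw [Fintype.card_finset, Fintype.card_fin] at this
  exact_mod_cast this

theorem SqGlobal.linkES_sq_le {μ : (∀ i, V i) → ℝ} (hμ : ∀ x, 0 ≤ μ x) {d : ℕ} {δ : ℝ}
    (hδ : 0 ≤ δ) {f : (∀ i, V i) → ℝ} (h : SqGlobal μ d δ f) {U P : Finset (Fin k)}
    (hUP : (U ∪ P).card ≤ d) (z : ∀ i, V i) :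
    (linkES μ U P f ^ 2) z ≤ (2 ^ k * δ) ^ 2 := by
  have h1 : |linkES μ U P f z| ≤ 2 ^ P.card * δ := abs_linkES_le fun T hT =>
    abs_le_of_sq_le_sq ((sq_avg_le hμ _ f z).trans
      (h _ ((card_le_card (union_subset_union_right hT)).trans hUP) z)) hδ
  rw [Pi.pow_apply, ← sq_abs]
  exact pow_le_pow_left₀ (abs_nonneg _)
    (h1.trans (mul_le_mul_of_nonneg_right (two_pow_card_le P) hδ)) 2

theorem avg_empty_linkES_sq_le {μ : (∀ i, V i) → ℝ} (hμ : ∀ x, 0 ≤ μ x)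
    (f : (∀ i, V i) → ℝ) (U P : Finset (Fin k)) (x : ∀ i, V i) :
    avg μ ∅ (linkES μ U P f ^ 2) x ≤ (2 ^ k) ^ 2 * avg μ ∅ (f ^ 2) x :=
  (avg_linkES_sq_le hμ (empty_subset U) P f x).trans (mul_le_mul_of_nonneg_right
    (pow_le_pow_left₀ (by positivity) (two_pow_card_le P) 2) (avg_sq_nonneg hμ ∅ f x))

theorem SqGlobal.avg_linkES_four_le {μ : (∀ i, V i) → ℝ} (hμ : ∀ x, 0 ≤ μ x) {d : ℕ} {δ : ℝ}
    (hδ : 0 ≤ δ) {f : (∀ i, V i) → ℝ} (h : SqGlobal μ d δ f) {U P : Finset (Fin k)}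
    (hUP : (U ∪ P).card ≤ d) (x : ∀ i, V i) :
    avg μ ∅ ((linkES μ U P f ^ 2) ^ 2) x ≤ (2 ^ k) ^ 4 * δ ^ 2 * avg μ ∅ (f ^ 2) x := by
  rw [sq (linkES μ U P f ^ 2)]
  refine (avg_mul_le_of_le hμ ∅ (h.linkES_sq_le hμ hδ hUP) (fun z => by
    simp [sq_nonneg]) x).trans ?_
  calc _ ≤ (2 ^ k * δ) ^ 2 * ((2 ^ k) ^ 2 * avg μ ∅ (f ^ 2) x) :=
        mul_le_mul_of_nonneg_left (avg_empty_linkES_sq_le hμ f U P x) (by positivity)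
    _ = _ := by ring

/-- The sets of size at most `d`. -/
def lowSets (k d : ℕ) : Finset (Finset (Fin k)) := univ.filter fun S => S.card ≤ d

theorem mem_lowSets {d : ℕ} {S : Finset (Fin k)} : S ∈ lowSets k d ↔ S.card ≤ d := by
  simp [lowSets]

/-- The total squared mass, given the coordinates in `R`, of the low components above `R`. -/
noncomputable def upperMass (μ : (∀ i, V i) → ℝ) (d : ℕ) (f : (∀ i, V i) → ℝ)
    (R : Finset (Fin k)) : (∀ i, V i) → ℝ :=
  ∑ S ∈ (lowSets k d).filter (R ⊆ ·), avg μ R (linkES μ ∅ S f ^ 2)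

theorem upperMass_nonneg {μ : (∀ i, V i) → ℝ} (hμ : ∀ x, 0 ≤ μ x) (d : ℕ)
    (f : (∀ i, V i) → ℝ) (R : Finset (Fin k)) (z : ∀ i, V i) : 0 ≤ upperMass μ d f R z := by
  rw [upperMass, Finset.sum_apply]
  exact Finset.sum_nonneg fun S _ => avg_sq_nonneg hμ R _ z

theorem upperMass_junta (μ : (∀ i, V i) → ℝ) (d : ℕ) (f : (∀ i, V i) → ℝ)
    (R : Finset (Fin k)) : Junta R (upperMass μ d f R) :=
  Junta.sum fun _ _ => avg_junta μ R _

theorem avg_upperMass {μ : (∀ i, V i) → ℝ} (hμ : ∀ x, 0 ≤ μ x) (d : ℕ)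
    (f : (∀ i, V i) → ℝ) (R : Finset (Fin k)) (x : ∀ i, V i) :
    avg μ ∅ (upperMass μ d f R) x
      = ∑ S ∈ (lowSets k d).filter (R ⊆ ·), avg μ ∅ (linkES μ ∅ S f ^ 2) x := by
  rw [upperMass, map_sum, Finset.sum_apply]
  exact Finset.sum_congr rfl fun _ _ => by rw [avg_avg hμ (empty_subset R)]

theorem SqGlobal.avg_upperMass_sq_le_crude {μ : (∀ i, V i) → ℝ} (hμ : ∀ x, 0 ≤ μ x) {d : ℕ}
    {δ : ℝ} (hδ : 0 ≤ δ) {f : (∀ i, V i) → ℝ} (h : SqGlobal μ d δ f) (R : Finset (Fin k))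
    (x : ∀ i, V i) :
    avg μ ∅ (upperMass μ d f R ^ 2) x ≤ (2 ^ k) ^ 6 * δ ^ 2 * avg μ ∅ (f ^ 2) x := by
  set N : ℝ := 2 ^ k with hN
  have hn := avg_sq_nonneg hμ ∅ f x
  have hsup : ∀ z, upperMass μ d f R z ≤ N * (N * δ) ^ 2 := by
    intro z
    rw [upperMass, Finset.sum_apply]
    have h1 : ∀ S ∈ (lowSets k d).filter (R ⊆ ·),
        avg μ R (linkES μ ∅ S f ^ 2) z ≤ (N * δ) ^ 2 := by
      intro S hS
      have hS' := mem_lowSets.1 (mem_filter.1 hS).1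
      exact (avg_mono hμ R (fun y _ => h.linkES_sq_le hμ hδ (by rwa [empty_union]) y) z).trans
        (avg_const_le R (by positivity) z)
    refine (Finset.sum_le_sum h1).trans ?_
    rw [Finset.sum_const, nsmul_eq_mul]
    exact mul_le_mul_of_nonneg_right (card_family_le _) (by positivity)
  have hL : avg μ ∅ (upperMass μ d f R) x ≤ N * (N ^ 2 * avg μ ∅ (f ^ 2) x) := by
    rw [avg_upperMass hμ]
    refine (Finset.sum_le_sum fun _ _ => avg_empty_linkES_sq_le hμ f ∅ _ x).trans ?_
    rw [Finset.sum_const, nsmul_eq_mul]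
    exact mul_le_mul_of_nonneg_right (card_family_le _) (by positivity)
  rw [sq (upperMass μ d f R)]
  refine (avg_mul_le_of_le hμ ∅ hsup (upperMass_nonneg hμ d f R) x).trans ?_
  calc _ ≤ N * (N * δ) ^ 2 * (N * (N ^ 2 * avg μ ∅ (f ^ 2) x)) :=
        mul_le_mul_of_nonneg_left hL (by positivity)
    _ = _ := by ring

theorem SqGlobal.avg_upperMass_sq_le {μ : (∀ i, V i) → ℝ} {ε : ℝ} (hμ : ∀ x, 0 ≤ μ x)
    (hε : 0 ≤ ε) (hP : EpsProduct μ ε) (hsmall : ε * (3 * (2 ^ k) ^ 4 * k ^ 2) ≤ 1) {d : ℕ}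
    {δ : ℝ} (hδ : 0 ≤ δ) {f : (∀ i, V i) → ℝ} (h : SqGlobal μ d δ f) {R : Finset (Fin k)}
    (hR : R.card ≤ d) (x : ∀ i, V i) :
    avg μ ∅ (upperMass μ d f R ^ 2) x ≤ 2 * 4 ^ d * δ ^ 2 * avg μ ∅ (upperMass μ d f R) x
      + (2 ^ k) ^ 8 * (ε * k ^ 2 * δ ^ 2 * avg μ ∅ (f ^ 2) x) := by
  set N : ℝ := 2 ^ k with hN
  set n := avg μ ∅ (f ^ 2) x with hn
  have hn0 : 0 ≤ n := avg_sq_nonneg hμ ∅ f x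
  set G := upperMass μ d f R with hGdef
  have hG0 : ∀ z, 0 ≤ G z := upperMass_nonneg hμ d f R
  set 𝓕 := (lowSets k d).filter (R ⊆ ·) with h𝓕
  have hmem : ∀ S ∈ 𝓕, S.card ≤ d ∧ R ⊆ S := fun S hS =>
    ⟨mem_lowSets.1 (mem_filter.1 hS).1, (mem_filter.1 hS).2⟩
  have e1 : avg μ ∅ (G ^ 2) x = ∑ S ∈ 𝓕, avg μ ∅ (G * linkES μ ∅ S f ^ 2) x := by
    have : G ^ 2 = ∑ S ∈ 𝓕, G * avg μ R (linkES μ ∅ S f ^ 2) := by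
      rw [← Finset.mul_sum, sq]
      rfl
    rw [this, map_sum, Finset.sum_apply]
    exact Finset.sum_congr rfl fun S _ => by
      rw [avg_avg_mul hμ (empty_subset R) (upperMass_junta μ d f R)]
  have e2 : ∀ S ∈ 𝓕, avg μ ∅ (G * linkES μ ∅ S f ^ 2) x
      ≤ 2 ^ R.card * ∑ T ∈ R.powerset, avg μ ∅ (G * linkES μ T (S \ R) f ^ 2) x := by
    intro S hS
    have hu := linkES_union μ (disjoint_sdiff (s := R) (t := S)) f
    rw [union_sdiff_of_subset (hmem S hS).2] at hu
    have h1 : ∀ z, (G * linkES μ ∅ S f ^ 2) z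
        ≤ (R.powerset.card • ∑ T ∈ R.powerset, G * linkES μ T (S \ R) f ^ 2) z := by
      intro z
      have h2 := sum_sq_le_card_mul R.powerset
        (fun T => (-1 : ℝ) ^ (R.card - T.card) • linkES μ T (S \ R) f) z
      simp only [← hu, smul_pow, ← pow_mul, mul_comm _ 2] at h2
      simp only [pow_mul, neg_one_sq, one_pow, one_smul] at h2
      rw [← Finset.mul_sum, ← mul_smul_comm]
      exact mul_le_mul_of_nonneg_left h2 (hG0 z)
    refine (avg_mono hμ ∅ (fun z _ => h1 z) x).trans (le_of_eq ?_)
    rw [map_nsmul, map_sum, Pi.smul_apply, Finset.sum_apply, nsmul_eq_mul, card_powerset]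
    push_cast
    rfl
  have e3 : ∀ S ∈ 𝓕, ∀ T ∈ R.powerset, avg μ ∅ (G * linkES μ T (S \ R) f ^ 2) x
      ≤ avg μ ∅ (avg μ T G * avg μ T (linkES μ T (S \ R) f ^ 2)) x
        + ε * k ^ 2 * (N ^ 5 * δ ^ 2 * n) := by
    intro S hS T hT
    have hTR := mem_powerset.1 hT
    have hI : R ∩ (T ∪ S \ R) = T := by
      rw [inter_union_distrib_left, inter_sdiff_self, union_empty, inter_eq_right.2 hTR]
    have hcard : (T ∪ S \ R).card ≤ d := (card_le_card (union_subset
      (hTR.trans (hmem S hS).2) sdiff_subset)).trans (hmem S hS).1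
    have h1 := abs_avg_mul_sub_le hμ hε hP (empty_subset _) (upperMass_junta μ d f R)
      ((linkES_junta μ T (S \ R) f).pow 2) x
    rw [hI] at h1
    have h2 : √(avg μ ∅ (G ^ 2) x * avg μ ∅ ((linkES μ T (S \ R) f ^ 2) ^ 2) x)
        ≤ N ^ 5 * δ ^ 2 * n := by
      rw [Real.sqrt_le_left (by positivity)]
      calc _ ≤ (N ^ 6 * δ ^ 2 * n) * (N ^ 4 * δ ^ 2 * n) :=
            mul_le_mul (h.avg_upperMass_sq_le_crude hμ hδ R x)
              (h.avg_linkES_four_le hμ hδ hcard x) (avg_sq_nonneg hμ ∅ _ x) (by positivity)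
        _ = _ := by ring
    have h3 := mul_le_mul_of_nonneg_left h2 (by positivity : 0 ≤ ε * (k : ℝ) ^ 2)
    linarith [(abs_le.1 h1).2]
  have e4 : ∀ T ∈ R.powerset,
      ∑ S ∈ 𝓕, avg μ ∅ (avg μ T G * avg μ T (linkES μ T (S \ R) f ^ 2)) x
        ≤ 2 * δ ^ 2 * avg μ ∅ G x := by
    intro T hT
    have hTR := mem_powerset.1 hT
    rw [← Finset.sum_apply, ← map_sum, ← Finset.mul_sum, mul_comm (avg μ T G)]
    refine (avg_mul_le_of_le hμ ∅ (c := 2 * δ ^ 2) (fun z => ?_)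
      (avg_nonneg hμ T fun z _ => hG0 z) x).trans
        (by rw [avg_avg hμ (empty_subset T)])
    have hinj : Set.InjOn (fun S => S \ R) (𝓕 : Set (Finset (Fin k))) := by
      intro S hS S' hS' hSS
      have h1 := union_sdiff_of_subset (hmem S hS).2
      have h2 := union_sdiff_of_subset (hmem S' hS').2
      simp only at hSS
      rw [← h1, hSS, h2]
    have hb := sum_avg_linkES_sq_le hμ hε hP hsmall T (𝓕.image fun S => S \ R)
      (fun P hPm => by
        obtain ⟨S, _, rfl⟩ := mem_image.1 hPm
        exact disjoint_sdiff.mono_left hTR) f z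
    rw [Finset.sum_image hinj] at hb
    rw [Finset.sum_apply]
    linarith [h T ((card_le_card hTR).trans hR) z]
  have hLG : 0 ≤ avg μ ∅ G x := avg_nonneg hμ ∅ (fun z _ => hG0 z) x
  set D := ε * k ^ 2 * δ ^ 2 * n with hD
  have hD0 : 0 ≤ D := by positivity
  have hRN : (2 : ℝ) ^ R.card ≤ N := two_pow_card_le R
  have hR0 : (0 : ℝ) < 2 ^ R.card := by positivity
  have e5 : ∑ T ∈ R.powerset, ∑ S ∈ 𝓕, avg μ ∅ (G * linkES μ T (S \ R) f ^ 2) x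
      ≤ 2 ^ R.card * (2 * δ ^ 2 * avg μ ∅ G x + N * (N ^ 5 * D)) := by
    have h1 : ∀ T ∈ R.powerset, ∑ S ∈ 𝓕, avg μ ∅ (G * linkES μ T (S \ R) f ^ 2) x
        ≤ 2 * δ ^ 2 * avg μ ∅ G x + N * (N ^ 5 * D) := by
      intro T hT
      refine (Finset.sum_le_sum fun S hS => e3 S hS T hT).trans ?_
      rw [Finset.sum_add_distrib, Finset.sum_const, nsmul_eq_mul]
      refine add_le_add (e4 T hT) ?_
      rw [show ε * k ^ 2 * (N ^ 5 * δ ^ 2 * n) = N ^ 5 * D by rw [hD]; ring]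
      exact mul_le_mul_of_nonneg_right (card_family_le _) (by positivity)
    refine (Finset.sum_le_sum h1).trans (le_of_eq ?_)
    rw [Finset.sum_const, nsmul_eq_mul, card_powerset]
    push_cast
    rfl
  rw [e1]
  refine (Finset.sum_le_sum e2).trans ?_
  rw [← Finset.mul_sum, Finset.sum_comm]
  refine (mul_le_mul_of_nonneg_left e5 hR0.le).trans ?_
  have f1 : (2 : ℝ) ^ R.card * 2 ^ R.card ≤ 4 ^ d := by
    rw [← mul_pow]
    norm_num
    exact pow_le_pow_right₀ (by norm_num) hR
  have f2 : (2 : ℝ) ^ R.card * 2 ^ R.card ≤ N * N := mul_le_mul hRN hRN hR0.le (by positivity)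
  have g1 := mul_le_mul_of_nonneg_right f1
    (by positivity : 0 ≤ 2 * δ ^ 2 * avg μ ∅ G x)
  have g2 := mul_le_mul_of_nonneg_right f2 (by positivity : 0 ≤ N * (N ^ 5 * D))
  calc _ = 2 ^ R.card * 2 ^ R.card * (2 * δ ^ 2 * avg μ ∅ G x)
        + 2 ^ R.card * 2 ^ R.card * (N * (N ^ 5 * D)) := by ring
    _ ≤ 4 ^ d * (2 * δ ^ 2 * avg μ ∅ G x) + N * N * (N * (N ^ 5 * D)) := add_le_add g1 g2
    _ = _ := by ring

theorem SqGlobal.sum_avg_upperMass_sq_le {μ : (∀ i, V i) → ℝ} {ε : ℝ} (hμ : ∀ x, 0 ≤ μ x)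
    (hε : 0 ≤ ε) (hP : EpsProduct μ ε) (hsmall : ε * (3 * (2 ^ k) ^ 4 * k ^ 2) ≤ 1) {d : ℕ}
    {δ : ℝ} (hδ : 0 ≤ δ) {f : (∀ i, V i) → ℝ} (h : SqGlobal μ d δ f) (x : ∀ i, V i) :
    ∑ R, avg μ ∅ (upperMass μ d f R ^ 2) x ≤ 4 * 8 ^ d * δ ^ 2 * avg μ ∅ (f ^ 2) x
      + (2 ^ k) ^ 9 * (ε * k ^ 2 * δ ^ 2 * avg μ ∅ (f ^ 2) x) := by
  set N : ℝ := 2 ^ k with hN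
  set n := avg μ ∅ (f ^ 2) x with hn
  have hn0 : 0 ≤ n := avg_sq_nonneg hμ ∅ f x
  have h1 : ∀ R : Finset (Fin k), avg μ ∅ (upperMass μ d f R ^ 2) x
      ≤ 2 * 4 ^ d * δ ^ 2 * avg μ ∅ (upperMass μ d f R) x
        + N ^ 8 * (ε * k ^ 2 * δ ^ 2 * n) := by
    intro R
    by_cases hR : R.card ≤ d
    · exact h.avg_upperMass_sq_le hμ hε hP hsmall hδ hR x
    · have : upperMass μ d f R = 0 := Finset.sum_eq_zero fun S hS => by
        obtain ⟨hS1, hS2⟩ := mem_filter.1 hS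
        exact absurd ((card_le_card hS2).trans (mem_lowSets.1 hS1)) hR
      rw [this, zero_pow two_ne_zero, map_zero, Pi.zero_apply]
      positivity
  have h2 : ∑ R, avg μ ∅ (upperMass μ d f R) x ≤ 2 ^ d * (2 * n) := by
    simp_rw [avg_upperMass hμ, Finset.sum_filter]
    rw [Finset.sum_comm]
    have h3 : ∀ S ∈ lowSets k d, (∑ R : Finset (Fin k),
        if R ⊆ S then avg μ ∅ (linkES μ ∅ S f ^ 2) x else 0)
          ≤ 2 ^ d * avg μ ∅ (linkES μ ∅ S f ^ 2) x := by
      intro S hS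
      have h4 : (univ.filter fun R => R ⊆ S) = S.powerset := by
        ext R
        simp
      rw [← Finset.sum_filter, h4, Finset.sum_const, nsmul_eq_mul, card_powerset]
      push_cast
      exact mul_le_mul_of_nonneg_right
        (pow_le_pow_right₀ one_le_two (mem_lowSets.1 hS)) (avg_sq_nonneg hμ ∅ _ x)
    refine (Finset.sum_le_sum h3).trans ?_
    rw [← Finset.mul_sum]
    exact mul_le_mul_of_nonneg_left (sum_avg_linkES_sq_le hμ hε hP hsmall ∅ (lowSets k d)
      (fun P _ => disjoint_empty_left P) f x) (by positivity)
  refine (Finset.sum_le_sum fun R _ => h1 R).trans ?_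
  rw [Finset.sum_add_distrib, ← Finset.mul_sum, Finset.sum_const, nsmul_eq_mul]
  have h5 := mul_le_mul_of_nonneg_left h2 (by positivity : 0 ≤ 2 * 4 ^ d * δ ^ 2)
  have h6 := mul_le_mul_of_nonneg_right (card_family_le (univ : Finset (Finset (Fin k))))
    (by positivity : 0 ≤ N ^ 8 * (ε * k ^ 2 * δ ^ 2 * n))
  have h8 : (8 : ℝ) ^ d = 4 ^ d * 2 ^ d := by rw [← mul_pow]; norm_num
  rw [h8]
  calc _ ≤ _ := add_le_add h5 h6
    _ = _ := by rw [← hN]; ring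
theorem abs_pow_two_fun (g : (∀ i, V i) → ℝ) : |g| ^ 2 = g ^ 2 :=
  funext fun z => sq_abs (g z)

theorem abs_mul_fun (g h : (∀ i, V i) → ℝ) : |g * h| = |g| * |h| :=
  funext fun z => abs_mul (g z) (h z)

/-- `T` contains the symmetric difference of the two sets and is contained in their union. -/
def Between (T : Finset (Fin k)) (p : Finset (Fin k) × Finset (Fin k)) : Prop :=
  T ⊆ p.1 ∪ p.2 ∧ p.1 \ T = p.2 \ T

instance (T : Finset (Fin k)) : DecidablePred (Between T) := fun p =>
  inferInstanceAs (Decidable (T ⊆ p.1 ∪ p.2 ∧ p.1 \ T = p.2 \ T))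

/-- The averaged absolute products of pairs of low components interacting through `T`. -/
noncomputable def pairMass (μ : (∀ i, V i) → ℝ) (d : ℕ) (f : (∀ i, V i) → ℝ)
    (T : Finset (Fin k)) : (∀ i, V i) → ℝ :=
  ∑ p ∈ (lowSets k d ×ˢ lowSets k d).filter (Between T),
    avg μ T |linkES μ ∅ p.1 f * linkES μ ∅ p.2 f|

/-- The averaged squared mass of the low components with a given trace `A` on `T`. -/
noncomputable def traceMass (μ : (∀ i, V i) → ℝ) (d : ℕ) (f : (∀ i, V i) → ℝ)
    (T A : Finset (Fin k)) : (∀ i, V i) → ℝ :=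
  ∑ S ∈ (lowSets k d).filter (fun S => S ∩ T = A), avg μ T (linkES μ ∅ S f ^ 2)

/-- The pairs of low sets with union `T`. -/
def coverPairs (d : ℕ) (T : Finset (Fin k)) : Finset (Finset (Fin k) × Finset (Fin k)) :=
  (lowSets k d ×ˢ lowSets k d).filter fun q => q.1 ∪ q.2 = T

theorem card_coverPairs_le (d : ℕ) (T : Finset (Fin k)) : (coverPairs d T).card ≤ 16 ^ d := by
  rcases (coverPairs d T).eq_empty_or_nonempty with h | ⟨q, hq⟩
  · simp [h]
  have hsub : coverPairs d T ⊆ T.powerset ×ˢ T.powerset := by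
    intro p hp
    have := (mem_filter.1 hp).2
    rw [mem_product, mem_powerset, mem_powerset, ← this]
    exact ⟨subset_union_left, subset_union_right⟩
  obtain ⟨h1, h2⟩ := mem_filter.1 hq
  obtain ⟨h3, h4⟩ := mem_product.1 h1
  have hT : T.card ≤ 2 * d := by
    have := card_union_le q.1 q.2
    rw [h2] at this
    have := mem_lowSets.1 h3
    have := mem_lowSets.1 h4
    omega
  refine (card_le_card hsub).trans ?_
  rw [card_product, card_powerset, ← mul_pow]
  calc (2 * 2) ^ T.card ≤ (2 * 2) ^ (2 * d) := Nat.pow_le_pow_right (by norm_num) hT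
    _ = 16 ^ d := by rw [pow_mul]; norm_num

theorem sum_fiber_sq_le {μ : (∀ i, V i) → ℝ} (hμ : ∀ x, 0 ≤ μ x) (d : ℕ)
    (f : (∀ i, V i) → ℝ) (T : Finset (Fin k)) (q : Finset (Fin k) × Finset (Fin k))
    (z : ∀ i, V i) :
    (∑ p ∈ ((lowSets k d ×ˢ lowSets k d).filter (Between T)).filter
        (fun p => (p.1 ∩ T, p.2 ∩ T) = q),
      avg μ T |linkES μ ∅ p.1 f * linkES μ ∅ p.2 f| z) ^ 2
      ≤ traceMass μ d f T q.1 z * traceMass μ d f T q.2 z := by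
  set I := ((lowSets k d ×ˢ lowSets k d).filter (Between T)).filter
    (fun p => (p.1 ∩ T, p.2 ∩ T) = q) with hI
  have hmem : ∀ p ∈ I, p.1 ∈ lowSets k d ∧ p.2 ∈ lowSets k d ∧ p.1 \ T = p.2 \ T ∧
      p.1 ∩ T = q.1 ∧ p.2 ∩ T = q.2 := by
    intro p hp
    obtain ⟨h1, h2⟩ := mem_filter.1 hp
    obtain ⟨h3, h4⟩ := mem_filter.1 h1
    obtain ⟨h5, h6⟩ := mem_product.1 h3
    exact ⟨h5, h6, h4.2, by rw [← h2], by rw [← h2]⟩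
  have hcs : (∑ p ∈ I, avg μ T |linkES μ ∅ p.1 f * linkES μ ∅ p.2 f| z) ^ 2
      ≤ (∑ p ∈ I, avg μ T (linkES μ ∅ p.1 f ^ 2) z)
        * ∑ p ∈ I, avg μ T (linkES μ ∅ p.2 f ^ 2) z := by
    refine Finset.sum_sq_le_sum_mul_sum_of_sq_le_mul _ (fun p _ => avg_sq_nonneg hμ T _ z)
      (fun p _ => avg_sq_nonneg hμ T _ z) fun p _ => ?_
    have := avg_mul_sq_le hμ T |linkES μ ∅ p.1 f| |linkES μ ∅ p.2 f| z
    rwa [abs_pow_two_fun, abs_pow_two_fun, ← abs_mul_fun] at this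
  have hinj1 : Set.InjOn Prod.fst (I : Set (Finset (Fin k) × Finset (Fin k))) := by
    intro p hp p' hp' h
    obtain ⟨_, _, h1, _, h2⟩ := hmem p hp
    obtain ⟨_, _, h1', _, h2'⟩ := hmem p' hp'
    refine Prod.ext h ?_
    rw [← sdiff_union_inter p.2 T, ← sdiff_union_inter p'.2 T, ← h1, ← h1', h, h2, h2']
  have hinj2 : Set.InjOn Prod.snd (I : Set (Finset (Fin k) × Finset (Fin k))) := by
    intro p hp p' hp' h
    obtain ⟨_, _, h1, h2, _⟩ := hmem p hp
    obtain ⟨_, _, h1', h2', _⟩ := hmem p' hp'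
    refine Prod.ext ?_ h
    rw [← sdiff_union_inter p.1 T, ← sdiff_union_inter p'.1 T, h1, h1', h, h2, h2']
  refine hcs.trans (mul_le_mul ?_ ?_ (Finset.sum_nonneg fun p _ => avg_sq_nonneg hμ T _ z) ?_)
  · rw [traceMass, Finset.sum_apply,
      ← Finset.sum_image (f := fun S => avg μ T (linkES μ ∅ S f ^ 2) z) hinj1]
    refine Finset.sum_le_sum_of_subset_of_nonneg (fun S hS => ?_)
      fun S _ _ => avg_sq_nonneg hμ T _ z
    obtain ⟨p, hp, rfl⟩ := mem_image.1 hS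
    exact mem_filter.2 ⟨(hmem p hp).1, (hmem p hp).2.2.2.1⟩
  · rw [traceMass, Finset.sum_apply,
      ← Finset.sum_image (f := fun S => avg μ T (linkES μ ∅ S f ^ 2) z) hinj2]
    refine Finset.sum_le_sum_of_subset_of_nonneg (fun S hS => ?_)
      fun S _ _ => avg_sq_nonneg hμ T _ z
    obtain ⟨p, hp, rfl⟩ := mem_image.1 hS
    exact mem_filter.2 ⟨(hmem p hp).2.1, (hmem p hp).2.2.2.2⟩
  · rw [traceMass, Finset.sum_apply]
    exact Finset.sum_nonneg fun S _ => avg_sq_nonneg hμ T _ z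

theorem pairMass_sq_le {μ : (∀ i, V i) → ℝ} (hμ : ∀ x, 0 ≤ μ x) (d : ℕ)
    (f : (∀ i, V i) → ℝ) (T : Finset (Fin k)) (z : ∀ i, V i) :
    (pairMass μ d f T ^ 2) z ≤ ((16 : ℝ) ^ d •
      ∑ q ∈ coverPairs d T, traceMass μ d f T q.1 * traceMass μ d f T q.2) z := by
  have hmaps : ∀ p ∈ (lowSets k d ×ˢ lowSets k d).filter (Between T),
      (p.1 ∩ T, p.2 ∩ T) ∈ coverPairs d T := by
    intro p hp
    obtain ⟨h3, h4⟩ := mem_filter.1 hp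
    obtain ⟨h5, h6⟩ := mem_product.1 h3
    refine mem_filter.2 ⟨mem_product.2 ⟨?_, ?_⟩, ?_⟩
    · exact mem_lowSets.2 ((card_le_card inter_subset_left).trans (mem_lowSets.1 h5))
    · exact mem_lowSets.2 ((card_le_card inter_subset_left).trans (mem_lowSets.1 h6))
    · rw [← union_inter_distrib_right]
      exact inter_eq_right.2 h4.1
  rw [Pi.pow_apply, pairMass, Finset.sum_apply, ← Finset.sum_fiberwise_of_maps_to hmaps,
    Pi.smul_apply, Finset.sum_apply, smul_eq_mul]
  refine sq_sum_le_card_mul_sum_sq.trans (mul_le_mul ?_ ?_ ?_ (by positivity))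
  · exact_mod_cast card_coverPairs_le d T
  · exact Finset.sum_le_sum fun q _ => sum_fiber_sq_le hμ d f T q z
  · exact Finset.sum_nonneg fun q _ => sq_nonneg _

/-- Decoupling of a product of two averages. -/
theorem avg_avg_mul_avg_le {μ : (∀ i, V i) → ℝ} {ε : ℝ} (hμ : ∀ x, 0 ≤ μ x) (hε : 0 ≤ ε)
    (hP : EpsProduct μ ε) (S S' T : Finset (Fin k)) {u v : (∀ i, V i) → ℝ} (hu : Junta S u)
    (hv : Junta S' v) {X : ℝ} (x : ∀ i, V i) (hX : 0 ≤ X) (huX : avg μ ∅ (u ^ 2) x ≤ X)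
    (hvX : avg μ ∅ (v ^ 2) x ≤ X) :
    avg μ ∅ (avg μ T u * avg μ T v) x
      ≤ avg μ ∅ (avg μ (S ∩ S' ∩ T) u * avg μ (S ∩ S' ∩ T) v) x + 2 * (ε * k ^ 2 * X) := by
  have hle : ∀ a b : (∀ i, V i) → ℝ, avg μ ∅ (a ^ 2) x ≤ X → avg μ ∅ (b ^ 2) x ≤ X →
      ε * k ^ 2 * √(avg μ ∅ (a ^ 2) x * avg μ ∅ (b ^ 2) x) ≤ ε * k ^ 2 * X := by
    intro a b ha hb
    refine mul_le_mul_of_nonneg_left ?_ (by positivity)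
    rw [Real.sqrt_le_left hX, sq X]
    exact mul_le_mul ha hb (avg_sq_nonneg hμ ∅ b x) hX
  have h1 := abs_avg_mul_sub_le hμ hε hP (empty_subset _) hu (avg_junta μ T v) x
  have h1' := hle u (avg μ T v) huX ((avg_sq_avg_le hμ (empty_subset T) v x).trans hvX)
  rw [avg_avg hμ inter_subset_right, avg_avg_mul hμ (empty_subset _) (avg_junta μ (S ∩ T) u)]
    at h1
  have h2 := abs_avg_mul_sub_le hμ hε hP (empty_subset _) (avg_junta μ (S ∩ T) u) hv x
  have h2' := hle (avg μ (S ∩ T) u) v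
    ((avg_sq_avg_le hμ (empty_subset _) u x).trans huX) hvX
  rw [avg_avg hμ inter_subset_left, inter_right_comm] at h2
  have h3 : avg μ ∅ (avg μ T u * avg μ T v) x = avg μ ∅ (u * avg μ T v) x := by
    rw [mul_comm, avg_avg_mul hμ (empty_subset T) (avg_junta μ T v), mul_comm]
  linarith [(abs_le.1 h1).2, (abs_le.1 h2).2]

theorem SqGlobal.sum_avg_pairMass_sq_le {μ : (∀ i, V i) → ℝ} {ε : ℝ} (hμ : ∀ x, 0 ≤ μ x)
    (hε : 0 ≤ ε) (hP : EpsProduct μ ε) {d : ℕ} {δ : ℝ} (hδ : 0 ≤ δ) {f : (∀ i, V i) → ℝ}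
    (h : SqGlobal μ d δ f) (x : ∀ i, V i) :
    ∑ T, avg μ ∅ (pairMass μ d f T ^ 2) x
      ≤ 16 ^ d * (4 ^ d * ∑ R, avg μ ∅ (upperMass μ d f R ^ 2) x
        + 2 * (2 ^ k) ^ 7 * (ε * k ^ 2 * δ ^ 2 * avg μ ∅ (f ^ 2) x)) := by
  set N : ℝ := 2 ^ k with hN
  set n := avg μ ∅ (f ^ 2) x with hn
  have hn0 : 0 ≤ n := avg_sq_nonneg hμ ∅ f x
  set D := ε * k ^ 2 * δ ^ 2 * n with hD
  have hD0 : 0 ≤ D := by positivity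
  set a : Finset (Fin k) → (∀ i, V i) → ℝ := fun S => linkES μ ∅ S f with ha
  have haJ : ∀ S, Junta S (a S ^ 2) := fun S => by
    have := linkES_junta μ ∅ S f
    rw [empty_union] at this
    exact this.pow 2
  set H : Finset (Fin k) → Finset (Fin k) → Finset (Fin k) → ℝ := fun S S' R =>
    avg μ ∅ (avg μ R (a S ^ 2) * avg μ R (a S' ^ 2)) x with hH
  have hH0 : ∀ S S' R, 0 ≤ H S S' R := fun S S' R => avg_nonneg hμ ∅ (fun z _ =>
    mul_nonneg (avg_sq_nonneg hμ R _ z) (avg_sq_nonneg hμ R _ z)) x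
  have hstep : ∀ S ∈ lowSets k d, ∀ S' ∈ lowSets k d, ∀ T,
      H S S' T ≤ H S S' (S ∩ S' ∩ T) + 2 * (N ^ 4 * D) := by
    intro S hS S' hS' T
    have hX : ∀ S ∈ lowSets k d, avg μ ∅ ((a S ^ 2) ^ 2) x ≤ N ^ 4 * δ ^ 2 * n :=
      fun S hS => h.avg_linkES_four_le hμ hδ (by rw [empty_union]; exact mem_lowSets.1 hS) x
    have := avg_avg_mul_avg_le hμ hε hP S S' T (haJ S) (haJ S') x (by positivity)
      (hX S hS) (hX S' hS')
    rw [show ε * k ^ 2 * (N ^ 4 * δ ^ 2 * n) = N ^ 4 * D by rw [hD]; ring] at this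
    exact this
  have hT : ∀ T, avg μ ∅ (pairMass μ d f T ^ 2) x
      ≤ 16 ^ d * ∑ p ∈ lowSets k d ×ˢ lowSets k d,
        if T ⊆ p.1 ∪ p.2 then H p.1 p.2 T else 0 := by
    intro T
    refine (avg_mono hμ ∅ (fun z _ => pairMass_sq_le hμ d f T z) x).trans ?_
    rw [map_smul, Pi.smul_apply, smul_eq_mul, map_sum, Finset.sum_apply]
    refine mul_le_mul_of_nonneg_left (le_of_eq ?_) (by positivity)
    have hmaps : ∀ p ∈ (lowSets k d ×ˢ lowSets k d).filter (fun p => T ⊆ p.1 ∪ p.2),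
        (p.1 ∩ T, p.2 ∩ T) ∈ coverPairs d T := by
      intro p hp
      obtain ⟨h3, h4⟩ := mem_filter.1 hp
      obtain ⟨h5, h6⟩ := mem_product.1 h3
      refine mem_filter.2 ⟨mem_product.2 ⟨?_, ?_⟩, ?_⟩
      · exact mem_lowSets.2 ((card_le_card inter_subset_left).trans (mem_lowSets.1 h5))
      · exact mem_lowSets.2 ((card_le_card inter_subset_left).trans (mem_lowSets.1 h6))
      · rw [← union_inter_distrib_right]
        exact inter_eq_right.2 h4
    rw [← Finset.sum_filter, ← Finset.sum_fiberwise_of_maps_to hmaps]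
    refine Finset.sum_congr rfl fun q hq => ?_
    have hqT := (mem_filter.1 hq).2
    rw [traceMass, traceMass, Finset.sum_mul_sum, map_sum, Finset.sum_apply]
    simp_rw [map_sum, Finset.sum_apply]
    rw [← Finset.sum_product']
    refine Finset.sum_congr ?_ fun p _ => rfl
    ext p
    simp only [mem_product, mem_filter, Prod.ext_iff]
    constructor
    · rintro ⟨⟨h1, h2⟩, h3, h4⟩
      refine ⟨⟨⟨h1, h3⟩, ?_⟩, h2, h4⟩
      rw [← hqT, ← h2, ← h4]
      exact union_subset_union inter_subset_left inter_subset_left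
    · rintro ⟨⟨⟨h1, h3⟩, _⟩, h2, h4⟩
      exact ⟨⟨h1, h2⟩, h3, h4⟩
  have hpair : ∀ p ∈ lowSets k d ×ˢ lowSets k d,
      (∑ T, if T ⊆ p.1 ∪ p.2 then H p.1 p.2 T else 0)
        ≤ 4 ^ d * (∑ R, if R ⊆ p.1 ∧ R ⊆ p.2 then H p.1 p.2 R else 0)
          + N * (2 * (N ^ 4 * D)) := by
    rintro ⟨S, S'⟩ hp
    obtain ⟨hS, hS'⟩ := mem_product.1 hp
    dsimp only at hS hS' ⊢
    have h4 : (univ.filter fun T => T ⊆ S ∪ S') = (S ∪ S').powerset := by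
      ext R
      simp only [mem_filter, mem_univ, true_and, mem_powerset]
    rw [← Finset.sum_filter, h4]
    set B := ∑ R, if R ⊆ S ∧ R ⊆ S' then H S S' R else 0 with hB
    have h0 : ∀ R, 0 ≤ if R ⊆ S ∧ R ⊆ S' then H S S' R else 0 := fun R => by
      split_ifs
      · exact hH0 _ _ _
      · exact le_rfl
    have hB0 : 0 ≤ B := Finset.sum_nonneg fun R _ => h0 R
    have h1 : ∀ T ∈ (S ∪ S').powerset, H S S' T ≤ B + 2 * (N ^ 4 * D) := by
      intro T _
      refine (hstep S hS S' hS' T).trans (add_le_add_left ?_ _)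
      have h2 := Finset.single_le_sum (fun R _ => h0 R) (mem_univ (S ∩ S' ∩ T))
      rwa [if_pos ⟨inter_subset_left.trans inter_subset_left,
        inter_subset_left.trans inter_subset_right⟩] at h2
    refine (Finset.sum_le_sum h1).trans ?_
    rw [Finset.sum_const, nsmul_eq_mul, mul_add]
    refine add_le_add (mul_le_mul_of_nonneg_right ?_ hB0)
      (mul_le_mul_of_nonneg_right (card_family_le _) (by positivity))
    have hc : (S ∪ S').card ≤ 2 * d := by
      have := card_union_le S S'
      have := mem_lowSets.1 hS
      have := mem_lowSets.1 hS'
      omega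
    rw [card_powerset, show (4 : ℝ) ^ d = 2 ^ (2 * d) by rw [pow_mul]; norm_num]
    push_cast
    exact pow_le_pow_right₀ one_le_two hc
  have hupper : ∀ R, avg μ ∅ (upperMass μ d f R ^ 2) x
      = ∑ p ∈ lowSets k d ×ˢ lowSets k d, if R ⊆ p.1 ∧ R ⊆ p.2 then H p.1 p.2 R else 0 := by
    intro R
    rw [← Finset.sum_filter, Finset.filter_product (fun S => R ⊆ S) (fun S => R ⊆ S),
      Finset.sum_product, sq, upperMass, Finset.sum_mul_sum, map_sum, Finset.sum_apply]
    simp_rw [map_sum, Finset.sum_apply]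
    rfl
  refine (Finset.sum_le_sum fun T _ => hT T).trans ?_
  rw [← Finset.mul_sum, Finset.sum_comm]
  refine mul_le_mul_of_nonneg_left ?_ (by positivity)
  refine (Finset.sum_le_sum hpair).trans ?_
  rw [Finset.sum_add_distrib, ← Finset.mul_sum, Finset.sum_comm, Finset.sum_const,
    nsmul_eq_mul]
  simp_rw [← hupper]
  refine add_le_add_right ?_ _
  rw [card_product]
  push_cast
  calc _ ≤ N * N * (N * (2 * (N ^ 4 * D))) :=
        mul_le_mul_of_nonneg_right (mul_le_mul (card_family_le _) (card_family_le _)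
          (by positivity) (by positivity)) (by positivity)
    _ = _ := by ring
theorem between_inter {A B W : Finset (Fin k)} (hA : A ⊆ B ∪ W) (hB : B ⊆ A ∪ W) :
    Between ((A ∪ B) ∩ W) (A, B) := by
  refine ⟨inter_subset_left, ?_⟩
  ext i
  have h1 := @hA i
  have h2 := @hB i
  simp only [mem_sdiff, mem_inter, mem_union] at *
  tauto

/-- A component with a private coordinate is almost orthogonal to the other three. -/
theorem SqGlobal.abs_avg_quad_le_of_not_subset {μ : (∀ i, V i) → ℝ} {ε : ℝ}
    (hμ : ∀ x, 0 ≤ μ x) (hε : 0 ≤ ε) (hP : EpsProduct μ ε) {d : ℕ} {δ : ℝ} (hδ : 0 ≤ δ)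
    {f : (∀ i, V i) → ℝ} (h : SqGlobal μ d δ f) {A B C S : Finset (Fin k)}
    (hA : A ∈ lowSets k d) (hB : B ∈ lowSets k d) (hS : ¬ S ⊆ A ∪ B ∪ C) (x : ∀ i, V i) :
    |avg μ ∅ (linkES μ ∅ A f * linkES μ ∅ B f * linkES μ ∅ C f * linkES μ ∅ S f) x|
      ≤ (2 ^ k) ^ 4 * (ε * k ^ 2 * δ ^ 2 * avg μ ∅ (f ^ 2) x) := by
  set N : ℝ := 2 ^ k with hN
  set n := avg μ ∅ (f ^ 2) x with hn
  have hn0 : 0 ≤ n := avg_sq_nonneg hμ ∅ f x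
  have hJ : ∀ T, Junta T (linkES μ ∅ T f) := fun T => by
    have := linkES_junta μ ∅ T f
    rwa [empty_union] at this
  have hsup : ∀ T ∈ lowSets k d, ∀ z, (linkES μ ∅ T f ^ 2) z ≤ (N * δ) ^ 2 := fun T hT =>
    h.linkES_sq_le hμ hδ (by rw [empty_union]; exact mem_lowSets.1 hT)
  have h1 := abs_avg_mul_linkES_le hμ hε hP f (empty_subset _)
    ((((hJ A).mono (subset_union_left.trans subset_union_left)).mul
      ((hJ B).mono (subset_union_right.trans subset_union_left))).mul
        ((hJ C).mono subset_union_right)) hS x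
  refine h1.trans ?_
  have h2 : avg μ ∅ ((linkES μ ∅ A f * linkES μ ∅ B f * linkES μ ∅ C f) ^ 2) x
      ≤ ((N * δ) ^ 2 * (N * δ) ^ 2) * (N ^ 2 * n) := by
    rw [mul_pow, mul_pow]
    refine (avg_mul_le_of_le hμ ∅ (c := (N * δ) ^ 2 * (N * δ) ^ 2) (fun z => ?_) (fun z => ?_)
      x).trans (mul_le_mul_of_nonneg_left (avg_empty_linkES_sq_le hμ f ∅ C x) (by positivity))
    · exact mul_le_mul (hsup A hA z) (hsup B hB z) (sq_nonneg _) (by positivity)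
    · exact sq_nonneg _
  have h3 : √(avg μ ∅ ((linkES μ ∅ A f * linkES μ ∅ B f * linkES μ ∅ C f) ^ 2) x * n)
      ≤ N ^ 3 * δ ^ 2 * n := by
    rw [Real.sqrt_le_left (by positivity)]
    refine (mul_le_mul_of_nonneg_right h2 hn0).trans (le_of_eq (by ring))
  refine (mul_le_mul_of_nonneg_left h3 (by positivity)).trans (le_of_eq (by ring))

/-- A quadruple correlation is controlled by the pairs interacting through a common set. -/
theorem SqGlobal.avg_quad_le {μ : (∀ i, V i) → ℝ} {ε : ℝ} (hμ : ∀ x, 0 ≤ μ x) (hε : 0 ≤ ε)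
    (hP : EpsProduct μ ε) {d : ℕ} {δ : ℝ} (hδ : 0 ≤ δ) {f : (∀ i, V i) → ℝ}
    (h : SqGlobal μ d δ f) {p q : Finset (Fin k) × Finset (Fin k)}
    (hp : p ∈ lowSets k d ×ˢ lowSets k d) (hq : q ∈ lowSets k d ×ˢ lowSets k d)
    (x : ∀ i, V i) :
    avg μ ∅ (linkES μ ∅ p.1 f * linkES μ ∅ p.2 f * (linkES μ ∅ q.1 f * linkES μ ∅ q.2 f)) x
      ≤ (∑ T, if Between T p ∧ Between T q then
          avg μ ∅ (avg μ T |linkES μ ∅ p.1 f * linkES μ ∅ p.2 f|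
            * avg μ T |linkES μ ∅ q.1 f * linkES μ ∅ q.2 f|) x else 0)
        + (2 ^ k) ^ 4 * (ε * k ^ 2 * δ ^ 2 * avg μ ∅ (f ^ 2) x) := by
  obtain ⟨A, B⟩ := p
  obtain ⟨C, S⟩ := q
  obtain ⟨hA, hB⟩ := mem_product.1 hp
  obtain ⟨hC, hS⟩ := mem_product.1 hq
  dsimp only at hA hB hC hS ⊢
  set N : ℝ := 2 ^ k with hN
  set n := avg μ ∅ (f ^ 2) x with hn
  have hn0 : 0 ≤ n := avg_sq_nonneg hμ ∅ f x
  set a : Finset (Fin k) → (∀ i, V i) → ℝ := fun S => linkES μ ∅ S f with ha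
  have h0 : ∀ T, 0 ≤ if Between T (A, B) ∧ Between T (C, S) then
      avg μ ∅ (avg μ T |a A * a B| * avg μ T |a C * a S|) x else 0 := fun T => by
    split_ifs
    · exact avg_nonneg hμ ∅ (fun z _ => mul_nonneg (avg_nonneg hμ T (fun _ _ => abs_nonneg _) z)
        (avg_nonneg hμ T (fun _ _ => abs_nonneg _) z)) x
    · exact le_rfl
  have hbad : ∀ A' ∈ lowSets k d, ∀ B' ∈ lowSets k d, ∀ C' S', ¬ S' ⊆ A' ∪ B' ∪ C' →
      a A * a B * (a C * a S) = a A' * a B' * a C' * a S' →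
      avg μ ∅ (a A * a B * (a C * a S)) x ≤ (∑ T, if Between T (A, B) ∧ Between T (C, S) then
        avg μ ∅ (avg μ T |a A * a B| * avg μ T |a C * a S|) x else 0)
          + N ^ 4 * (ε * k ^ 2 * δ ^ 2 * n) := by
    intro A' hA' B' hB' C' S' hsub heq
    rw [heq]
    exact (le_of_abs_le (h.abs_avg_quad_le_of_not_subset hμ hε hP hδ hA' hB' hsub x)).trans
      (le_add_of_nonneg_left (Finset.sum_nonneg fun T _ => h0 T))
  by_cases h1 : S ⊆ A ∪ B ∪ C
  swap
  · exact hbad A hA B hB C S h1 (by ring)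
  by_cases h2 : C ⊆ A ∪ B ∪ S
  swap
  · exact hbad A hA B hB S C h2 (by ring)
  by_cases h3 : B ⊆ C ∪ S ∪ A
  swap
  · exact hbad C hC S hS A B h3 (by ring)
  by_cases h4 : A ⊆ C ∪ S ∪ B
  swap
  · exact hbad C hC S hS B A h4 (by ring)
  have hb1 := between_inter (h4.trans (by rw [union_comm B])) (h3.trans (by rw [union_comm A]))
  have hb2 : Between ((A ∪ B) ∩ (C ∪ S)) (C, S) := by
    rw [inter_comm]
    exact between_inter (h2.trans (by rw [union_comm S])) (h1.trans (by rw [union_comm C]))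
  have hmain := Finset.single_le_sum (fun T _ => h0 T) (mem_univ ((A ∪ B) ∩ (C ∪ S)))
  rw [if_pos ⟨hb1, hb2⟩] at hmain
  have hJ : ∀ S T, Junta (S ∪ T) |a S * a T| := fun S T => by
    have h5 := linkES_junta μ ∅ S f
    have h6 := linkES_junta μ ∅ T f
    rw [empty_union] at h5 h6
    exact ((h5.mono subset_union_left).mul (h6.mono subset_union_right)).abs
  have hsq : ∀ S ∈ lowSets k d, ∀ T, avg μ ∅ (|a S * a T| ^ 2) x
      ≤ (N * δ) ^ 2 * (N ^ 2 * n) := by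
    intro S hS T
    rw [abs_pow_two_fun, mul_pow]
    exact (avg_mul_le_of_le hμ ∅ (h.linkES_sq_le hμ hδ (by
      rw [empty_union]; exact mem_lowSets.1 hS)) (fun z => sq_nonneg _) x).trans
        (mul_le_mul_of_nonneg_left (avg_empty_linkES_sq_le hμ f ∅ T x) (by positivity))
  have h5 := abs_avg_mul_sub_le hμ hε hP (empty_subset _) (hJ A B) (hJ C S) x
  have h6 : √(avg μ ∅ (|a A * a B| ^ 2) x * avg μ ∅ (|a C * a S| ^ 2) x)
      ≤ (N * δ) ^ 2 * (N ^ 2 * n) := by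
    rw [Real.sqrt_le_left (by positivity), sq (_ * (_ * n))]
    exact mul_le_mul (hsq A hA B) (hsq C hC S) (avg_sq_nonneg hμ ∅ _ x) (by positivity)
  have h7 := mul_le_mul_of_nonneg_left h6 (by positivity : 0 ≤ ε * (k : ℝ) ^ 2)
  have h8 : avg μ ∅ (a A * a B * (a C * a S)) x ≤ avg μ ∅ (|a A * a B| * |a C * a S|) x := by
    rw [← abs_mul_fun]
    exact avg_mono hμ ∅ (fun z _ => le_abs_self _) x
  have h9 : ε * k ^ 2 * ((N * δ) ^ 2 * (N ^ 2 * n)) = N ^ 4 * (ε * k ^ 2 * δ ^ 2 * n) := by ring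
  linarith [(abs_le.1 h5).2]

/-- The low-degree part as a function. -/
theorem lowPart_eq_sum (μ : (∀ i, V i) → ℝ) (d : ℕ) (f : (∀ i, V i) → ℝ) :
    lowPart μ d f = ∑ S ∈ lowSets k d, linkES μ ∅ S f := by
  funext z
  rw [lowPart, powerset_univ, Finset.sum_apply]
  exact Finset.sum_congr rfl fun S _ => congrFun (ES_eq_linkES μ S f) z

theorem SqGlobal.avg_lowPart_four_le {μ : (∀ i, V i) → ℝ} {ε : ℝ} (hμ : ∀ x, 0 ≤ μ x)
    (hε : 0 ≤ ε) (hP : EpsProduct μ ε) {d : ℕ} {δ : ℝ} (hδ : 0 ≤ δ) {f : (∀ i, V i) → ℝ}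
    (h : SqGlobal μ d δ f) (x : ∀ i, V i) :
    avg μ ∅ (lowPart μ d f ^ 4) x ≤ ∑ T, avg μ ∅ (pairMass μ d f T ^ 2) x
      + (2 ^ k) ^ 8 * (ε * k ^ 2 * δ ^ 2 * avg μ ∅ (f ^ 2) x) := by
  set N : ℝ := 2 ^ k with hN
  set n := avg μ ∅ (f ^ 2) x with hn
  have hn0 : 0 ≤ n := avg_sq_nonneg hμ ∅ f x
  set D := ε * k ^ 2 * δ ^ 2 * n with hD
  have hD0 : 0 ≤ D := by positivity
  set I := lowSets k d ×ˢ lowSets k d with hI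
  have hexp : lowPart μ d f ^ 4 = ∑ p ∈ I, ∑ q ∈ I,
      linkES μ ∅ p.1 f * linkES μ ∅ p.2 f * (linkES μ ∅ q.1 f * linkES μ ∅ q.2 f) := by
    have h2 : lowPart μ d f ^ 2 = ∑ p ∈ I, linkES μ ∅ p.1 f * linkES μ ∅ p.2 f := by
      rw [lowPart_eq_sum, sq, Finset.sum_mul_sum, Finset.sum_product]
    rw [show 4 = 2 * 2 from rfl, pow_mul, h2, sq, Finset.sum_mul_sum]
  have hmass : ∀ T, avg μ ∅ (pairMass μ d f T ^ 2) x = ∑ p ∈ I, ∑ q ∈ I,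
      if Between T p ∧ Between T q then
        avg μ ∅ (avg μ T |linkES μ ∅ p.1 f * linkES μ ∅ p.2 f|
          * avg μ T |linkES μ ∅ q.1 f * linkES μ ∅ q.2 f|) x else 0 := by
    intro T
    rw [sq, pairMass, Finset.sum_mul_sum, map_sum, Finset.sum_apply, Finset.sum_filter]
    refine Finset.sum_congr rfl fun p _ => ?_
    rw [map_sum, Finset.sum_apply, Finset.sum_filter]
    by_cases hpT : Between T p <;> simp [hpT, hI]
  have hcard : (I.card : ℝ) ≤ N * N := by
    rw [hI, card_product]
    push_cast
    exact mul_le_mul (card_family_le _) (card_family_le _) (by positivity) (by positivity)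
  rw [hexp, map_sum, Finset.sum_apply]
  simp_rw [map_sum, Finset.sum_apply]
  refine (Finset.sum_le_sum fun p hp => Finset.sum_le_sum fun q hq =>
    h.avg_quad_le hμ hε hP hδ hp hq x).trans ?_
  simp_rw [Finset.sum_add_distrib, Finset.sum_const, nsmul_eq_mul, hmass]
  refine add_le_add (le_of_eq ?_) ?_
  · rw [Finset.sum_comm (s := univ)]
    exact Finset.sum_congr rfl fun p _ => Finset.sum_comm
  · calc _ ≤ N * N * (N * N * (N ^ 4 * D)) := mul_le_mul hcard
          (mul_le_mul_of_nonneg_right hcard (by positivity)) (by positivity) (by positivity)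
      _ = _ := by ring

theorem SqGlobal.avg_lowPart_four_le_of_small {μ : (∀ i, V i) → ℝ} {ε : ℝ}
    (hμ : ∀ x, 0 ≤ μ x) (hε : 0 ≤ ε) (hP : EpsProduct μ ε) {d : ℕ} (hd : d ≤ k)
    (hsmall : ε * (4 * (2 ^ k) ^ 15 * k ^ 2) ≤ 1) {δ : ℝ} (hδ : 0 ≤ δ)
    {f : (∀ i, V i) → ℝ} (h : SqGlobal μ d δ f) (x : ∀ i, V i) :
    avg μ ∅ (lowPart μ d f ^ 4) x ≤ 8 * 512 ^ d * δ ^ 2 * avg μ ∅ (f ^ 2) x := by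
  set N : ℝ := 2 ^ k with hN
  set n := avg μ ∅ (f ^ 2) x with hn
  have hn0 : 0 ≤ n := avg_sq_nonneg hμ ∅ f x
  have hN1 : 1 ≤ N := one_le_pow₀ one_le_two
  have hsmall' : ε * (3 * N ^ 4 * k ^ 2) ≤ 1 := by
    refine le_trans ?_ hsmall
    gcongr
    · norm_num
    · norm_num
  have h1 := h.avg_lowPart_four_le hμ hε hP hδ x
  have h2 := h.sum_avg_pairMass_sq_le hμ hε hP hδ x
  have h3 := h.sum_avg_upperMass_sq_le hμ hε hP hsmall' hδ x
  rw [← hN, ← hn] at h1 h2 h3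
  set D := ε * k ^ 2 * δ ^ 2 * n with hD
  have hD0 : 0 ≤ D := by positivity
  have h2d : (2 : ℝ) ^ d ≤ N := pow_le_pow_right₀ one_le_two hd
  have h4 : (4 : ℝ) ^ d ≤ N ^ 2 := by
    rw [show (4 : ℝ) = 2 ^ 2 by norm_num, ← pow_mul, mul_comm, pow_mul]
    gcongr
  have h16 : (16 : ℝ) ^ d ≤ N ^ 4 := by
    rw [show (16 : ℝ) = 2 ^ 4 by norm_num, ← pow_mul, mul_comm, pow_mul]
    gcongr
  have h512 : (512 : ℝ) ^ d = 16 ^ d * 4 ^ d * 8 ^ d := by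
    rw [← mul_pow, ← mul_pow]
    norm_num
  have herr : 4 * N ^ 15 * D ≤ δ ^ 2 * n := by
    calc 4 * N ^ 15 * D = ε * (4 * N ^ 15 * k ^ 2) * (δ ^ 2 * n) := by rw [hD]; ring
      _ ≤ 1 * (δ ^ 2 * n) := mul_le_mul_of_nonneg_right hsmall (by positivity)
      _ = _ := one_mul _
  have h5 : 16 ^ d * (4 ^ d * (N ^ 9 * D)) ≤ N ^ 15 * D := by
    calc _ ≤ N ^ 4 * (N ^ 2 * (N ^ 9 * D)) := by gcongr
      _ = _ := by ring
  have h6 : 16 ^ d * (2 * N ^ 7 * D) ≤ 2 * N ^ 15 * D := by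
    calc _ ≤ N ^ 4 * (2 * N ^ 7 * D) := by gcongr
      _ = 2 * N ^ 11 * D := by ring
      _ ≤ _ := by gcongr; norm_num
  have h7 : N ^ 8 * D ≤ N ^ 15 * D := by gcongr; norm_num
  have h8 : 16 ^ d * (4 ^ d * ∑ R, avg μ ∅ (upperMass μ d f R ^ 2) x + 2 * N ^ 7 * D)
      ≤ 16 ^ d * (4 ^ d * (4 * 8 ^ d * δ ^ 2 * n + N ^ 9 * D) + 2 * N ^ 7 * D) := by gcongr
  have h11 : 16 ^ d * (4 ^ d * (4 * 8 ^ d * δ ^ 2 * n + N ^ 9 * D) + 2 * N ^ 7 * D)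
      = 16 ^ d * (4 ^ d * (4 * 8 ^ d * δ ^ 2 * n)) + 16 ^ d * (4 ^ d * (N ^ 9 * D))
        + 16 ^ d * (2 * N ^ 7 * D) := by ring
  have h9 : δ ^ 2 * n ≤ 512 ^ d * (δ ^ 2 * n) :=
    le_mul_of_one_le_left (by positivity) (one_le_pow₀ (by norm_num))
  have h10 : 16 ^ d * (4 ^ d * (4 * 8 ^ d * δ ^ 2 * n)) = 4 * (512 ^ d * (δ ^ 2 * n)) := by
    rw [h512]
    ring
  rw [h11, h10] at h8
  calc _ ≤ 4 * (512 ^ d * (δ ^ 2 * n)) + 4 * (N ^ 15 * D) := by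
        linarith only [h1, h2, h5, h6, h7, h8]
    _ ≤ 8 * (512 ^ d * (δ ^ 2 * n)) := by linarith only [herr, h9, (by positivity : 0 ≤ δ ^ 2 * n)]
    _ = _ := by ring

theorem avg_empty_eq {μ : (∀ i, V i) → ℝ} (h : ∑ x, μ x = 1) (g : (∀ i, V i) → ℝ)
    (x : ∀ i, V i) : avg μ ∅ g x = ∑ z, μ z * g z := by
  simp [avg_apply, cond, marg, h]

theorem statement1 (ζ : ℝ) (hζ : 0 < ζ) (d : ℕ) (hd : 0 < d) :
    ∃ δ₀ : ℝ, 0 < δ₀ ∧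
      ∀ k : ℕ, d ≤ k →
        ∃ ε₀ : ℝ, 0 < ε₀ ∧
          ∀ (V : Fin k → Type) [∀ i, Fintype (V i)] [∀ i, DecidableEq (V i)]
            (μ : (∀ i, V i) → ℝ) (ε δ : ℝ) (f : (∀ i, V i) → ℝ),
            0 < ε → ε ≤ ε₀ → 0 < δ → δ ≤ δ₀ →
            IsProb μ → EpsProduct μ ε → IsGlobal μ d δ f →
            norm4p4 μ (lowPart μ d f) ≤ ζ * normSq μ f := by
  refine ⟨√(ζ / (8 * 512 ^ d)), by positivity, fun k hk =>
    ⟨1 / (4 * (2 ^ k) ^ 15 * (k ^ 2 + 1)), by positivity, ?_⟩⟩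
  intro V _ _ μ ε δ f hε hε₀ hδ hδ₀ hμ hP hf
  obtain ⟨x⟩ : Nonempty (∀ i, V i) := by
    by_contra hne
    rw [not_nonempty_iff] at hne
    simpa using hμ.2
  have hsmall : ε * (4 * (2 ^ k) ^ 15 * k ^ 2) ≤ 1 := by
    rw [le_div_iff₀ (by positivity)] at hε₀
    refine le_trans ?_ hε₀
    gcongr
    exact (lt_add_one _).le
  have h1 := (hf.sqGlobal hμ.1 hδ.le).avg_lowPart_four_le_of_small hμ.1 hε.le hP hk hsmall
    hδ.le x
  rw [avg_empty_eq hμ.2, avg_empty_eq hμ.2] at h1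
  have h2 : 8 * 512 ^ d * δ ^ 2 ≤ ζ := by
    have h3 := (Real.le_sqrt' hδ).1 hδ₀
    rw [le_div_iff₀ (by positivity)] at h3
    linarith
  exact h1.trans (mul_le_mul_of_nonneg_right h2
    (Finset.sum_nonneg fun z _ => mul_nonneg (hμ.1 z) (sq_nonneg _)))

end GLL
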